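/- arXiv:1412.0076 — 4 statements merged into one kernel-verified Lean document; each statement's English description precedes it below -/
import Mathlib

section
/- Fix p, q ∈ (1, ∞) and let A be the optimal (least) constant such that (∫_0^1 |f(x)|^q dx)^{1/q} ≤ A·(∫_0^1 |f'(x)|^p dx)^{1/p} holds for every absolutely continuous function f on (0, 1) with f(0) = 0. Then A = p^{1/q}·q^{1 - 1/p}·(pq + p - q)^{1/p - 1/q} / ( (p-1)^{1/p} · Beta(1/q, 1 - 1/p) ), where Beta denotes the Beta function. -/
open MeasureTheory Real Set Filter Topology ENNReal

noncomputable def hG (a b t : ℝ) : ℝ := ∫ u in (0:ℝ)..t, u ^ (a - 1) * (1 - u) ^ (b - 1)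

lemma w_int {a b : ℝ} (ha : 0 < a) (hb : 0 < b) :
    IntervalIntegrable (fun u : ℝ => u ^ (a - 1) * (1 - u) ^ (b - 1)) volume 0 1 := by
  have h := (Complex.betaIntegral_convergent (u := (a:ℂ)) (v := (b:ℂ)) (by simpa) (by simpa)).norm
  rw [intervalIntegrable_iff_integrableOn_Ioo_of_le zero_le_one] at h ⊢
  refine h.congr_fun ?_ measurableSet_Ioo
  intro x hx
  have h1 : (0:ℝ) < 1 - x := by linarith [hx.2]
  have e1 : ((x:ℂ) ^ ((a:ℂ) - 1)) = ((x ^ (a-1) : ℝ) : ℂ) := by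
    rw [Complex.ofReal_cpow hx.1.le]; simp
  have e2 : ((1 - (x:ℂ)) ^ ((b:ℂ) - 1)) = (((1 - x) ^ (b-1) : ℝ) : ℂ) := by
    rw [Complex.ofReal_cpow h1.le]; simp
  simp only [e1, e2]
  rw [← Complex.ofReal_mul, Complex.norm_real, Real.norm_of_nonneg]
  exact mul_nonneg (rpow_nonneg hx.1.le _) (rpow_nonneg h1.le _)

lemma hG_cont {a b : ℝ} (ha : 0 < a) (hb : 0 < b) : ContinuousOn (hG a b) (Icc 0 1) := by
  have := intervalIntegral.continuousOn_primitive_interval' (w_int ha hb) left_mem_uIcc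
  rwa [uIcc_of_le zero_le_one] at this

lemma hG_deriv {a b : ℝ} (ha : 0 < a) (hb : 0 < b) {t : ℝ} (ht : t ∈ Ioo (0:ℝ) 1) :
    HasDerivAt (hG a b) (t ^ (a - 1) * (1 - t) ^ (b - 1)) t := by
  have hc : ∀ x ∈ Ioo (0:ℝ) 1, ContinuousAt (fun u : ℝ => u ^ (a - 1) * (1 - u) ^ (b - 1)) x := by
    intro x hx
    have h1 : (1:ℝ) - x ≠ 0 := by linarith [hx.2]
    exact (continuousAt_id.rpow_const (Or.inl hx.1.ne')).mul
      ((continuousAt_const.sub continuousAt_id).rpow_const (Or.inl h1))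
  refine intervalIntegral.integral_hasDerivAt_right ?_ ?_ (hc t ht)
  · refine (w_int ha hb).mono_set ?_
    rw [uIcc_of_le zero_le_one, uIcc_of_le ht.1.le]
    exact Icc_subset_Icc_right ht.2.le
  · exact ContinuousOn.stronglyMeasurableAtFilter isOpen_Ioo
      (fun x hx => (hc x hx).continuousWithinAt) t ht

lemma hG_mono {a b : ℝ} (ha : 0 < a) (hb : 0 < b) : StrictMonoOn (hG a b) (Icc 0 1) := by
  refine strictMonoOn_of_deriv_pos (convex_Icc 0 1) (hG_cont ha hb) ?_
  intro x hx
  rw [interior_Icc] at hx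
  rw [(hG_deriv ha hb hx).deriv]
  exact mul_pos (rpow_pos_of_pos hx.1 _) (rpow_pos_of_pos (by linarith [hx.2]) _)

lemma hG_zero (a b : ℝ) : hG a b 0 = 0 := by simp [hG]

lemma hG_pos {a b : ℝ} (ha : 0 < a) (hb : 0 < b) : 0 < hG a b 1 := by
  have := hG_mono ha hb (by simp : (0:ℝ) ∈ Icc (0:ℝ) 1) (by simp : (1:ℝ) ∈ Icc (0:ℝ) 1) one_pos
  rwa [hG_zero] at this

/-- FTC bound. -/
lemma ftc_bound (g g' : ℝ → ℝ) (hd : ∀ x ∈ Ioo (0:ℝ) 1, HasDerivAt g (g' x) x)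
    (h0 : Tendsto g (𝓝[>] (0:ℝ)) (𝓝 0)) {b : ℝ} (hb : b ∈ Ioo (0:ℝ) 1) :
    ENNReal.ofReal |g b| ≤ ∫⁻ x in Ioo (0:ℝ) 1, ENNReal.ofReal |g' x| := by
  by_cases htop : ∫⁻ x in Ioo (0:ℝ) 1, ENNReal.ofReal |g' x| = ⊤
  · rw [htop]; exact le_top
  have hm : AEStronglyMeasurable g' (volume.restrict (Ioo (0:ℝ) 1)) := by
    refine (stronglyMeasurable_deriv g).aestronglyMeasurable.congr ?_
    filter_upwards [ae_restrict_mem measurableSet_Ioo] with x hx using (hd x hx).deriv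
  have hint : IntegrableOn g' (Ioo 0 1) := by
    refine ⟨hm, ?_⟩
    rw [hasFiniteIntegral_iff_norm]
    exact lt_top_iff_ne_top.2 htop
  have key : ∀ c ∈ Ioo (0:ℝ) b,
      ENNReal.ofReal |g b - g c| ≤ ∫⁻ x in Ioo (0:ℝ) 1, ENNReal.ofReal |g' x| := by
    intro c hc
    have hsub : Icc c b ⊆ Ioo (0:ℝ) 1 := fun x hx => ⟨hc.1.trans_le hx.1, hx.2.trans_lt hb.2⟩
    have e : ∫ x in c..b, g' x = g b - g c := by
      refine intervalIntegral.integral_eq_sub_of_hasDerivAt ?_ ?_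
      · rw [uIcc_of_le hc.2.le]; exact fun x hx => hd x (hsub hx)
      · rw [intervalIntegrable_iff_integrableOn_Icc_of_le hc.2.le]
        exact hint.mono_set hsub
    rw [← e, intervalIntegral.integral_of_le hc.2.le, ← Real.norm_eq_abs, ofReal_norm]
    refine (enorm_integral_le_lintegral_enorm _).trans ?_
    simp_rw [← ofReal_norm, Real.norm_eq_abs]
    exact lintegral_mono_set (Ioc_subset_Icc_self.trans hsub)
  have hlim : Tendsto (fun c => ENNReal.ofReal |g b - g c|) (𝓝[>] (0:ℝ))
      (𝓝 (ENNReal.ofReal |g b - 0|)) :=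
    ENNReal.tendsto_ofReal ((tendsto_const_nhds.sub h0).abs)
  rw [sub_zero] at hlim
  refine le_of_tendsto hlim ?_
  filter_upwards [Ioo_mem_nhdsGT hb.1] with c hc using key c hc

lemma amgm {a b x : ℝ} (ha : 0 < a) (hb : 0 < b) (hx : 0 ≤ x) (hx1 : x ≤ 1) :
    x ^ a * (1 - x) ^ b ≤ (a / (a + b)) ^ a * (b / (a + b)) ^ b := by
  have hs : 0 < a + b := by positivity
  have hy : 0 ≤ 1 - x := by linarith
  have hA : 0 < a / (a + b) := by positivity
  have hB : 0 < b / (a + b) := by positivity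
  have h := Real.geom_mean_le_arith_mean2_weighted hA.le hB.le
    (div_nonneg hx hA.le) (div_nonneg hy hB.le) (by field_simp)
  have e : a / (a + b) * (x / (a / (a + b))) + b / (a + b) * ((1 - x) / (b / (a + b))) = 1 := by
    field_simp; ring
  rw [e] at h
  have h2 := Real.rpow_le_rpow (by positivity) h hs.le
  rw [Real.one_rpow, Real.mul_rpow (by positivity) (by positivity), ← Real.rpow_mul (by positivity),
    ← Real.rpow_mul (by positivity), div_mul_cancel₀ _ hs.ne', div_mul_cancel₀ _ hs.ne',
    Real.div_rpow hx hA.le, Real.div_rpow hy hB.le, div_mul_div_comm, div_le_one (by positivity)] at h2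
  exact h2

/-- value of `K`. -/
lemma K_val {q b : ℝ} (hq : 1 < q) (hb : 0 < b) :
    ∫ s in (0:ℝ)..1, (max 0 (1 - |s| ^ q)) ^ b = b / (1 + b * q) * hG (1/q) b 1 := by
  have hq0 : 0 < q := by linarith
  have hcont : Continuous (fun s : ℝ => (max 0 (1 - |s| ^ q)) ^ b) := by
    refine Continuous.rpow_const ?_ (fun _ => Or.inr hb.le)
    exact continuous_const.max (continuous_const.sub (continuous_abs.rpow_const fun _ => Or.inr hq0.le))
  have key : ∫ s in (0:ℝ)..1, (1 + b * q) * (max 0 (1 - |s| ^ q)) ^ b =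
      (1 * (1 - 1 ^ q) ^ b + b * hG (1/q) b (1 ^ q)) - (0 * (1 - 0 ^ q) ^ b + b * hG (1/q) b (0 ^ q)) := by
    refine intervalIntegral.integral_eq_sub_of_hasDerivAt_of_le 
      (f := fun s : ℝ => s * (1 - s ^ q) ^ b + b * hG (1/q) b (s ^ q)) zero_le_one ?_ ?_ ?_
    · have hp : ContinuousOn (fun s : ℝ => s ^ q) (Icc 0 1) :=
        continuousOn_id.rpow_const fun _ _ => Or.inr hq0.le
      refine (continuousOn_id.mul ((continuousOn_const.sub hp).rpow_const fun _ _ => Or.inr hb.le)).add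
        (continuousOn_const.mul ((hG_cont (by positivity) hb).comp hp ?_))
      intro s hs
      exact ⟨rpow_nonneg hs.1 _, rpow_le_one hs.1 hs.2 hq0.le⟩
    · intro s hs
      have hsq : s ^ q ∈ Ioo (0:ℝ) 1 := ⟨rpow_pos_of_pos hs.1 _, rpow_lt_one hs.1.le hs.2 hq0⟩
      have h1 : 0 < 1 - s ^ q := by linarith [hsq.2]
      have d1 : HasDerivAt (fun s : ℝ => s ^ q) (q * s ^ (q - 1)) s :=
        Real.hasDerivAt_rpow_const (Or.inl hs.1.ne')
      have d2 := (d1.const_sub 1).rpow_const (p := b) (Or.inl h1.ne')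
      have d3 := (hG_deriv (a := 1/q) (by positivity) hb hsq).comp s d1
      have d4 := ((hasDerivAt_id s).mul d2).add (d3.const_mul b)
      refine d4.congr_deriv ?_
      rw [abs_of_pos hs.1, max_eq_right h1.le]
      have e1 : (1 - s ^ q) ^ (b - 1) = (1 - s ^ q) ^ b / (1 - s ^ q) := Real.rpow_sub_one h1.ne' _
      have e2 : s ^ (q - 1) = s ^ q / s := Real.rpow_sub_one hs.1.ne' _
      have e3 : (s ^ q) ^ (1 / q - 1) = s / s ^ q := by
        rw [Real.rpow_sub_one hsq.1.ne', ← Real.rpow_mul hs.1.le, mul_one_div_cancel hq0.ne', Real.rpow_one]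
      rw [e1, e2, e3]
      have hs0 := hs.1.ne'
      have hsq0 := hsq.1.ne'
      simp only [id]
      generalize (1 - s ^ q) ^ b = X at *
      generalize s ^ q = Y at *
      field_simp
      ring
    · exact (hcont.const_mul _).intervalIntegrable _ _
  rw [intervalIntegral.integral_const_mul] at key
  rw [Real.one_rpow, Real.zero_rpow hq0.ne', hG_zero, sub_self, Real.zero_rpow hb.ne'] at key
  have : 0 < 1 + b * q := by positivity
  field_simp
  linarith

lemma extremal {a b : ℝ} (ha : 0 < a) (hb : 0 < b) :
    ∃ Y : ℝ → ℝ, Continuous Y ∧ Y 0 = 0 ∧ Y 1 = 1 ∧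
      (∀ x ∈ Ioo (0:ℝ) 1, Y x ∈ Ioo (0:ℝ) 1) ∧
      ∀ x ∈ Ioo (0:ℝ) 1, HasDerivAt Y
        (hG a b 1 * (Y x ^ (a - 1) * (1 - Y x) ^ (b - 1))⁻¹) x := by
  set B := hG a b 1 with hBdef
  have hB : 0 < B := hG_pos ha hb
  have hmono := hG_mono ha hb
  have hsurj : ∀ x : Icc (0:ℝ) 1, ∃ y : Icc (0:ℝ) 1, hG a b y = B * x := by
    intro x
    have := intermediate_value_Icc zero_le_one (hG_cont ha hb)
    rw [hG_zero] at this
    obtain ⟨y, hy, e⟩ := this (show B * (x:ℝ) ∈ Icc 0 (hG a b 1) from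
      ⟨mul_nonneg hB.le x.2.1, mul_le_of_le_one_right hB.le x.2.2⟩)
    exact ⟨⟨y, hy⟩, e⟩
  choose y hy using hsurj
  have ylt : ∀ x x' : Icc (0:ℝ) 1, y x < y x' ↔ x < x' := by
    intro x x'
    have := hmono.lt_iff_lt (y x).2 (y x').2
    rw [hy, hy, mul_lt_mul_iff_right₀ hB] at this
    exact this.symm
  have ymono : StrictMono y := fun x x' h => (ylt x x').2 h
  have y0 : y ⟨0, by simp⟩ = ⟨0, by simp⟩ := by
    apply Subtype.ext
    apply hmono.injOn (y _).2 (by simp)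
    rw [hy]; simp [hG_zero]
  have y1 : y ⟨1, by simp⟩ = ⟨1, by simp⟩ := by
    apply Subtype.ext
    apply hmono.injOn (y _).2 (by simp)
    rw [hy]; simp [hBdef]
  have ysurj : Function.Surjective y := by
    intro t
    have h0 : 0 ≤ hG a b t := by
      have := hmono.monotoneOn (by simp : (0:ℝ) ∈ Icc (0:ℝ) 1) t.2 t.2.1
      rwa [hG_zero] at this
    have h1 : hG a b t ≤ B := hmono.monotoneOn t.2 (by simp) t.2.2
    refine ⟨⟨hG a b t / B, div_nonneg h0 hB.le, (div_le_one hB).2 h1⟩, ?_⟩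
    apply Subtype.ext
    apply hmono.injOn (y _).2 t.2
    rw [hy]; field_simp
  have ycont : Continuous y := ymono.monotone.continuous_of_surjective ysurj
  have hYcont : Continuous (fun x => (y (projIcc 0 1 zero_le_one x) : ℝ)) :=
    continuous_subtype_val.comp (ycont.comp continuous_projIcc)
  have hYmem : ∀ x ∈ Ioo (0:ℝ) 1, (y (projIcc 0 1 zero_le_one x) : ℝ) ∈ Ioo (0:ℝ) 1 := by
    intro x hx
    rw [projIcc_of_mem _ (Ioo_subset_Icc_self hx)]
    constructor
    · have : y ⟨0, by simp⟩ < y ⟨x, Ioo_subset_Icc_self hx⟩ := ymono hx.1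
      rw [y0] at this; exact this
    · have : y ⟨x, Ioo_subset_Icc_self hx⟩ < y ⟨1, by simp⟩ := ymono hx.2
      rw [y1] at this; exact this
  refine ⟨fun x => y (projIcc 0 1 zero_le_one x), hYcont, ?_, ?_, hYmem, ?_⟩
  · simp only [projIcc_left]; exact congrArg Subtype.val y0
  · simp only [projIcc_right]; exact congrArg Subtype.val y1
  · intro x hx
    have hd := (hG_deriv ha hb (hYmem x hx)).div_const B
    have hm := hYmem x hx
    have hne : 0 < (y (projIcc 0 1 zero_le_one x) : ℝ) ^ (a - 1) *
        (1 - (y (projIcc 0 1 zero_le_one x) : ℝ)) ^ (b - 1) :=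
      mul_pos (rpow_pos_of_pos hm.1 _) (rpow_pos_of_pos (by linarith [hm.2]) _)
    have := HasDerivAt.of_local_left_inverse
      (g := fun x => (y (projIcc 0 1 zero_le_one x) : ℝ)) (a := x) hYcont.continuousAt hd
      (div_pos hne hB).ne' ?_
    · refine this.congr_deriv ?_
      rw [inv_div, div_eq_mul_inv]
    · filter_upwards [Ioo_mem_nhds hx.1 hx.2] with z hz
      rw [projIcc_of_mem _ (Ioo_subset_Icc_self hz), hy]
      field_simp

lemma extremal_int {a b : ℝ} (ha : 0 < a) (hb : 0 < b) {Y : ℝ → ℝ} (hc : Continuous Y)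
    (h0 : Y 0 = 0) (h1 : Y 1 = 1) (hm : ∀ x ∈ Ioo (0:ℝ) 1, Y x ∈ Ioo (0:ℝ) 1)
    (hd : ∀ x ∈ Ioo (0:ℝ) 1, HasDerivAt Y
        (hG a b 1 * (Y x ^ (a - 1) * (1 - Y x) ^ (b - 1))⁻¹) x) :
    ∫ x in (0:ℝ)..1, Y x = a / (a + b) := by
  have hB := hG_pos ha hb
  set B := hG a b 1
  have key : ∫ x in (0:ℝ)..1, B * (a - (a + b) * Y x) =
      Y 1 ^ a * (1 - Y 1) ^ b - Y 0 ^ a * (1 - Y 0) ^ b := by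
    refine intervalIntegral.integral_eq_sub_of_hasDerivAt_of_le
      (f := fun x => Y x ^ a * (1 - Y x) ^ b) zero_le_one ?_ ?_ ?_
    · exact ((hc.rpow_const fun _ => Or.inr ha.le).mul
        ((continuous_const.sub hc).rpow_const fun _ => Or.inr hb.le)).continuousOn
    · intro x hx
      have hY := hm x hx
      have hY1 : 0 < 1 - Y x := by linarith [hY.2]
      have d := ((hd x hx).rpow_const (p := a) (Or.inl hY.1.ne')).mul
        (((hd x hx).const_sub 1).rpow_const (p := b) (Or.inl hY1.ne'))
      refine d.congr_deriv ?_
      rw [Real.rpow_sub_one hY.1.ne', Real.rpow_sub_one hY1.ne']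
      have p1 := (rpow_pos_of_pos hY.1 a).ne'
      have p2 := (rpow_pos_of_pos hY1 b).ne'
      have p3 := hY.1.ne'
      have p4 := hY1.ne'
      generalize (1 - Y x) ^ b = X at *
      generalize (Y x) ^ a = Z at *
      field_simp
      ring
    · exact Continuous.intervalIntegrable (by fun_prop) _ _
  rw [intervalIntegral.integral_const_mul, intervalIntegral.integral_sub
    (by simp) ((hc.const_mul _).intervalIntegrable _ _), intervalIntegral.integral_const_mul,
    h0, h1, Real.zero_rpow ha.ne', sub_self, Real.zero_rpow hb.ne'] at key
  simp at key
  have hs : 0 < a + b := by positivity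
  rcases key with h | h
  · exact absurd h hB.ne'
  · field_simp; linarith

lemma lint_of_cont {Y : ℝ → ℝ} (hc : Continuous Y) (hn : ∀ x ∈ Ioo (0:ℝ) 1, 0 ≤ Y x) :
    ∫⁻ x in Ioo (0:ℝ) 1, ENNReal.ofReal (Y x) = ENNReal.ofReal (∫ x in (0:ℝ)..1, Y x) := by
  rw [intervalIntegral.integral_of_le zero_le_one, integral_Ioc_eq_integral_Ioo,
    ofReal_integral_eq_lintegral_ofReal]
  · exact (hc.integrableOn_Icc (a := 0) (b := 1)).mono_set Ioo_subset_Icc_self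
  · filter_upwards [ae_restrict_mem measurableSet_Ioo] with x hx using hn x hx

lemma extremal_fun {p q : ℝ} (hp : 1 < p) (hq : 1 < q) {a b : ℝ} (ha : a = 1/q) (hb : b = 1 - 1/p) :
    ∃ f f' : ℝ → ℝ, (∀ x ∈ Ioo (0:ℝ) 1, HasDerivAt f (f' x) x) ∧
      Tendsto f (𝓝[>] (0:ℝ)) (𝓝 0) ∧
      (∫⁻ x in Ioo (0:ℝ) 1, ENNReal.ofReal |f x| ^ q) = ENNReal.ofReal (a / (a + b)) ∧
      (∫⁻ x in Ioo (0:ℝ) 1, ENNReal.ofReal |f' x| ^ p) =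
        ENNReal.ofReal ((a * hG a b 1) ^ p * (b / (a + b))) := by
  have hq0 : 0 < q := by linarith
  have hp0 : 0 < p := by linarith
  have ha0 : 0 < a := by rw [ha]; positivity
  have hb0 : 0 < b := by rw [hb, sub_pos, div_lt_one hp0]; exact hp
  obtain ⟨Y, hc, h0, h1, hm, hd⟩ := extremal ha0 hb0
  have hI := extremal_int ha0 hb0 hc h0 h1 hm hd
  have hB := hG_pos ha0 hb0
  set B := hG a b 1
  refine ⟨fun x => Y x ^ a, fun x => a * B * (1 - Y x) ^ (1 / p), ?_, ?_, ?_, ?_⟩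
  · intro x hx
    have hY := hm x hx
    have hY1 : 0 < 1 - Y x := by linarith [hY.2]
    refine ((hd x hx).rpow_const (p := a) (Or.inl hY.1.ne')).congr_deriv ?_
    have e : b - 1 = -(1/p) := by rw [hb]; ring
    rw [e, rpow_neg hY1.le]
    have p1 := (rpow_pos_of_pos hY.1 (a-1)).ne'
    have p2 := (rpow_pos_of_pos hY1 (1/p)).ne'
    field_simp
  · have : Continuous (fun x => Y x ^ a) := hc.rpow_const fun _ => Or.inr ha0.le
    have h := (this.tendsto 0).mono_left (nhdsWithin_le_nhds (s := Ioi 0))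
    simpa [h0, Real.zero_rpow ha0.ne'] using h
  · rw [← hI, ← lint_of_cont hc (fun x hx => (hm x hx).1.le)]
    refine setLIntegral_congr_fun measurableSet_Ioo ?_
    intro x hx
    have hY := hm x hx
    simp only
    rw [abs_of_pos (rpow_pos_of_pos hY.1 _), ENNReal.ofReal_rpow_of_nonneg (by have := hY.1; positivity) hq0.le,
      ← Real.rpow_mul hY.1.le, ha, one_div_mul_cancel hq0.ne', Real.rpow_one]
  · have hI2 : ∫ x in (0:ℝ)..1, (a * B) ^ p * (1 - Y x) = (a * B) ^ p * (b / (a + b)) := by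
      rw [intervalIntegral.integral_const_mul, intervalIntegral.integral_sub (by simp)
        (hc.intervalIntegrable _ _), hI]
      congr 1
      simp
      field_simp
      ring
    rw [← hI2, ← lint_of_cont (by fun_prop)]
    · refine setLIntegral_congr_fun measurableSet_Ioo ?_
      intro x hx
      have hY := hm x hx
      have hY1 : 0 < 1 - Y x := by linarith [hY.2]
      simp only
      rw [abs_of_pos (by positivity), ENNReal.ofReal_rpow_of_nonneg (by positivity) hp0.le,
        Real.mul_rpow (by positivity) (by positivity),
        ← Real.rpow_mul hY1.le, one_div_mul_cancel hp0.ne', Real.rpow_one]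
    · intro x hx
      have hY := hm x hx
      have hY1 : 0 < 1 - Y x := by linarith [hY.2]
      positivity

/-- upper bound, normalized. -/
lemma upper_norm {p q : ℝ} (hp : 1 < p) (hq : 1 < q) {b K : ℝ} (hb : b = 1 - 1/p)
    (hK : K = ∫ s in (0:ℝ)..1, (max 0 (1 - |s| ^ q)) ^ b)
    (g g' : ℝ → ℝ) (hd : ∀ x ∈ Ioo (0:ℝ) 1, HasDerivAt g (g' x) x)
    (h0 : Tendsto g (𝓝[>] (0:ℝ)) (𝓝 0))
    (hlub : IsLUB ((fun x => |g x|) '' Ioo (0:ℝ) 1) 1) :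
    ENNReal.ofReal K ≤ (∫⁻ x in Ioo (0:ℝ) 1, ENNReal.ofReal |g' x| ^ p) ^ (1/p) *
      (∫⁻ x in Ioo (0:ℝ) 1, ENNReal.ofReal (1 - |g x| ^ q)) ^ b := by
  have hq0 : 0 < q := by linarith
  have hp0 : 0 < p := by linarith
  have hb0 : 0 < b := by rw [hb, sub_pos, div_lt_one hp0]; exact hp
  set h : ℝ → ℝ := fun s => (max 0 (1 - |s| ^ q)) ^ b with hh
  have hcont : Continuous h := by
    refine Continuous.rpow_const ?_ (fun _ => Or.inr hb0.le)
    exact continuous_const.max (continuous_const.sub (continuous_abs.rpow_const fun _ => Or.inr hq0.le))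
  set H : ℝ → ℝ := fun s => ∫ u in (0:ℝ)..s, h u with hH
  have hHd : ∀ s, HasDerivAt H (h s) s := fun s => hcont.integral_hasStrictDerivAt 0 s |>.hasDerivAt
  have hHc : Continuous H := continuous_iff_continuousAt.2 fun s => (hHd s).continuousAt
  have hH0 : H 0 = 0 := by simp [hH]
  have hodd : ∀ s, H (-s) = - H s := by
    intro s
    have := intervalIntegral.integral_comp_neg (a := 0) (b := s) h
    have he : ∀ u, h (-u) = h u := fun u => by simp [hh]
    simp only [he, neg_zero] at this
    simp only [hH]
    rw [this, intervalIntegral.integral_symm]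
  have habs : ∀ s, H |s| ≤ |H s| := by
    intro s
    rcases abs_choice s with e | e <;> rw [e]
    · exact le_abs_self _
    · rw [hodd]; exact neg_le_abs _
  set I := ∫⁻ x in Ioo (0:ℝ) 1, ENNReal.ofReal |h (g x) * g' x| with hI
  have hb1 : ∀ x ∈ Ioo (0:ℝ) 1, ENNReal.ofReal |H (g x)| ≤ I := fun x hx =>
    ftc_bound (fun x => H (g x)) (fun x => h (g x) * g' x)
      (fun x hx => (hHd (g x)).comp x (hd x hx))
      (by have := (hHc.tendsto 0).comp h0; rw [hH0] at this; exact this) hx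
  have hcl : IsClosed {s : ℝ | ENNReal.ofReal (H s) ≤ I} :=
    isClosed_le (ENNReal.continuous_ofReal.comp hHc) continuous_const
  have hne : ((fun x => |g x|) '' Ioo (0:ℝ) 1).Nonempty := ⟨_, 1/2, by norm_num, rfl⟩
  have h1mem : (1:ℝ) ∈ {s : ℝ | ENNReal.ofReal (H s) ≤ I} := by
    refine hcl.closure_subset_iff.2 ?_ (hlub.mem_closure hne)
    rintro _ ⟨x, hx, rfl⟩
    exact (ENNReal.ofReal_le_ofReal (habs _)).trans (hb1 x hx)
  have hKI : ENNReal.ofReal K ≤ I := by rw [hK]; exact h1mem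
  refine hKI.trans ?_
  have hm' : AEMeasurable g' (volume.restrict (Ioo (0:ℝ) 1)) := by
    refine (measurable_deriv g).aemeasurable.congr ?_
    filter_upwards [ae_restrict_mem measurableSet_Ioo] with x hx using (hd x hx).deriv
  have hm : AEMeasurable g (volume.restrict (Ioo (0:ℝ) 1)) :=
    ContinuousOn.aemeasurable (fun x hx => (hd x hx).continuousAt.continuousWithinAt) measurableSet_Ioo
  have hconj : p.HolderConjugate b⁻¹ := by
    rw [Real.holderConjugate_iff]
    refine ⟨hp, ?_⟩
    rw [inv_inv, hb]; ring
  have hol := ENNReal.lintegral_mul_le_Lp_mul_Lq (volume.restrict (Ioo (0:ℝ) 1)) hconj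
    (f := fun x => ENNReal.ofReal |g' x|) (g := fun x => ENNReal.ofReal (h (g x)))
    (hm'.abs.ennreal_ofReal) ((hcont.measurable.comp_aemeasurable hm).ennreal_ofReal)
  have e1 : I = ∫⁻ x in Ioo (0:ℝ) 1, ((fun x => ENNReal.ofReal |g' x|) * fun x => ENNReal.ofReal (h (g x))) x := by
    rw [hI]
    refine lintegral_congr fun x => ?_
    have : 0 ≤ h (g x) := rpow_nonneg (le_max_left _ _) _
    rw [abs_mul, abs_of_nonneg this, mul_comm, ENNReal.ofReal_mul (abs_nonneg _)]; rfl
  have e2 : ∫⁻ x in Ioo (0:ℝ) 1, ENNReal.ofReal (h (g x)) ^ b⁻¹ = 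
      ∫⁻ x in Ioo (0:ℝ) 1, ENNReal.ofReal (1 - |g x| ^ q) := by
    refine lintegral_congr fun x => ?_
    have : 0 ≤ max 0 (1 - |g x| ^ q) := le_max_left _ _
    simp only [hh]
    rw [ENNReal.ofReal_rpow_of_nonneg (rpow_nonneg this _) (by positivity), ← Real.rpow_mul this,
      mul_inv_cancel₀ hb0.ne', Real.rpow_one, ENNReal.ofReal_max]
    simp
  rw [← e1, e2, one_div b⁻¹, inv_inv] at hol
  exact hol

lemma upper_norm2 {p q : ℝ} (hp : 1 < p) (hq : 1 < q) {a b K : ℝ} (ha : a = 1/q)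
    (hb : b = 1 - 1/p) (hKp : 0 < K)
    (hK : K = ∫ s in (0:ℝ)..1, (max 0 (1 - |s| ^ q)) ^ b)
    (g g' : ℝ → ℝ) (hd : ∀ x ∈ Ioo (0:ℝ) 1, HasDerivAt g (g' x) x)
    (h0 : Tendsto g (𝓝[>] (0:ℝ)) (𝓝 0))
    (hlub : IsLUB ((fun x => |g x|) '' Ioo (0:ℝ) 1) 1) :
    (∫⁻ x in Ioo (0:ℝ) 1, ENNReal.ofReal |g x| ^ q) ^ (1/q) ≤
      ENNReal.ofReal ((a / (a + b)) ^ a * (b / (a + b)) ^ b / K) *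
      (∫⁻ x in Ioo (0:ℝ) 1, ENNReal.ofReal |g' x| ^ p) ^ (1/p) := by
  have hq0 : 0 < q := by linarith
  have hp0 : 0 < p := by linarith
  have ha0 : 0 < a := by rw [ha]; positivity
  have hb0 : 0 < b := by rw [hb, sub_pos, div_lt_one hp0]; exact hp
  have hU := upper_norm hp hq hb hK g g' hd h0 hlub
  have hle : ∀ x ∈ Ioo (0:ℝ) 1, |g x| ≤ 1 := fun x hx => hlub.1 ⟨x, hx, rfl⟩
  have hle' : ∀ x ∈ Ioo (0:ℝ) 1, |g x| ^ q ≤ 1 := fun x hx =>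
    Real.rpow_le_one (abs_nonneg _) (hle x hx) hq0.le
  have hcont : ContinuousOn (fun x => |g x| ^ q) (Ioo 0 1) := fun x hx =>
    ((hd x hx).continuousAt.abs.rpow_const (Or.inr hq0.le)).continuousWithinAt
  have hint : IntegrableOn (fun x => |g x| ^ q) (Ioo 0 1) := by
    refine Integrable.of_bound (hcont.aestronglyMeasurable measurableSet_Ioo) 1 ?_
    filter_upwards [ae_restrict_mem measurableSet_Ioo] with x hx
    rw [Real.norm_of_nonneg (by positivity)]; exact hle' x hx
  set Q := ∫ x in Ioo (0:ℝ) 1, |g x| ^ q with hQ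
  have hQ0 : 0 ≤ Q := integral_nonneg fun x => by positivity
  have hint1 : IntegrableOn (fun _ : ℝ => (1:ℝ)) (Ioo 0 1) := by simp
  have eQ1 : ∫ x in Ioo (0:ℝ) 1, (1 - |g x| ^ q) = 1 - Q := by
    rw [integral_sub hint1 hint]; simp [hQ]
  have hQ1 : 0 ≤ 1 - Q := by
    rw [← eQ1]
    exact setIntegral_nonneg measurableSet_Ioo fun x hx => by linarith [hle' x hx]
  have e1 : ∫⁻ x in Ioo (0:ℝ) 1, ENNReal.ofReal |g x| ^ q = ENNReal.ofReal Q := by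
    rw [hQ, ofReal_integral_eq_lintegral_ofReal hint (ae_of_all _ fun x => by positivity)]
    exact lintegral_congr fun x => ENNReal.ofReal_rpow_of_nonneg (abs_nonneg _) hq0.le
  have e2 : ∫⁻ x in Ioo (0:ℝ) 1, ENNReal.ofReal (1 - |g x| ^ q) = ENNReal.ofReal (1 - Q) := by
    rw [← eQ1, ofReal_integral_eq_lintegral_ofReal (f := fun x => 1 - |g x| ^ q) (hint1.sub hint)]
    filter_upwards [ae_restrict_mem measurableSet_Ioo] with x hx
    simpa using hle' x hx
  rw [e2, ENNReal.ofReal_rpow_of_nonneg hQ1 hb0.le] at hU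
  rw [e1, ENNReal.ofReal_rpow_of_nonneg hQ0 (by positivity), ← ha]
  set E := (∫⁻ x in Ioo (0:ℝ) 1, ENNReal.ofReal |g' x| ^ p) ^ (1/p)
  have hQa : 0 ≤ Q ^ a / K := by positivity
  calc ENNReal.ofReal (Q ^ a) = ENNReal.ofReal (Q ^ a / K) * ENNReal.ofReal K := by
        rw [← ENNReal.ofReal_mul hQa, div_mul_cancel₀ _ hKp.ne']
    _ ≤ ENNReal.ofReal (Q ^ a / K) * (E * ENNReal.ofReal ((1 - Q) ^ b)) := by gcongr
    _ = ENNReal.ofReal (Q ^ a * (1 - Q) ^ b / K) * E := by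
        rw [mul_comm E, ← mul_assoc, ← ENNReal.ofReal_mul hQa, div_mul_eq_mul_div]
    _ ≤ _ := by
        refine mul_le_mul_left (ENNReal.ofReal_le_ofReal ?_) _
        exact div_le_div_of_nonneg_right (amgm ha0 hb0 hQ0 (by linarith)) hKp.le

lemma upper {p q : ℝ} (hp : 1 < p) (hq : 1 < q) {C : ℝ} (hC : 0 < C)
    (hn : ∀ g g' : ℝ → ℝ, (∀ x ∈ Ioo (0:ℝ) 1, HasDerivAt g (g' x) x) →
      Tendsto g (𝓝[>] (0:ℝ)) (𝓝 0) → IsLUB ((fun x => |g x|) '' Ioo (0:ℝ) 1) 1 →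
      (∫⁻ x in Ioo (0:ℝ) 1, ENNReal.ofReal |g x| ^ q) ^ (1/q) ≤
      ENNReal.ofReal C * (∫⁻ x in Ioo (0:ℝ) 1, ENNReal.ofReal |g' x| ^ p) ^ (1/p))
    (f f' : ℝ → ℝ) (hd : ∀ x ∈ Ioo (0:ℝ) 1, HasDerivAt f (f' x) x)
    (h0 : Tendsto f (𝓝[>] (0:ℝ)) (𝓝 0)) :
    (∫⁻ x in Ioo (0:ℝ) 1, ENNReal.ofReal |f x| ^ q) ^ (1/q) ≤
      ENNReal.ofReal C * (∫⁻ x in Ioo (0:ℝ) 1, ENNReal.ofReal |f' x| ^ p) ^ (1/p) := by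
  have hq0 : 0 < q := by linarith
  have hp0 : 0 < p := by linarith
  by_cases htop : ∫⁻ x in Ioo (0:ℝ) 1, ENNReal.ofReal |f' x| ^ p = ⊤
  · rw [htop, ENNReal.top_rpow_of_pos (by positivity), ENNReal.mul_top (by simpa using hC)]
    exact le_top
  have hm' : AEMeasurable f' (volume.restrict (Ioo (0:ℝ) 1)) := by
    refine (measurable_deriv f).aemeasurable.congr ?_
    filter_upwards [ae_restrict_mem measurableSet_Ioo] with x hx using (hd x hx).deriv
  have hfin : ∫⁻ x in Ioo (0:ℝ) 1, ENNReal.ofReal |f' x| ≠ ⊤ := by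
    have hol := ENNReal.lintegral_mul_le_Lp_mul_Lq (volume.restrict (Ioo (0:ℝ) 1))
      (Real.HolderConjugate.conjExponent hp)
      (f := fun x => ENNReal.ofReal |f' x|) (g := fun x => 1)
      (hm'.abs.ennreal_ofReal) aemeasurable_const
    simp only [Pi.mul_apply, mul_one, ENNReal.one_rpow, lintegral_const, Measure.restrict_apply_univ,
      Real.volume_Ioo, sub_zero, ENNReal.ofReal_one] at hol
    exact ne_top_of_le_ne_top (ENNReal.rpow_ne_top_of_nonneg (by positivity) htop) hol
  have hbd : BddAbove ((fun x => |f x|) '' Ioo (0:ℝ) 1) := by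
    refine ⟨(∫⁻ x in Ioo (0:ℝ) 1, ENNReal.ofReal |f' x|).toReal, ?_⟩
    rintro _ ⟨x, hx, rfl⟩
    exact (ENNReal.ofReal_le_iff_le_toReal hfin).1 (ftc_bound f f' hd h0 hx)
  have hne : ((fun x => |f x|) '' Ioo (0:ℝ) 1).Nonempty := ⟨_, 1/2, by norm_num, rfl⟩
  have hlub := isLUB_csSup hne hbd
  set M := sSup ((fun x => |f x|) '' Ioo (0:ℝ) 1) with hM
  have hM0 : 0 ≤ M := (abs_nonneg (f (1/2))).trans (hlub.1 ⟨1/2, by norm_num, rfl⟩)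
  rcases hM0.eq_or_lt with hz | hMp
  · have : ∫⁻ x in Ioo (0:ℝ) 1, ENNReal.ofReal |f x| ^ q = 0 := by
      rw [setLIntegral_congr_fun (g := fun _ => 0) measurableSet_Ioo]
      · simp
      · intro x hx
        have h1 : |f x| ≤ M := hlub.1 ⟨x, hx, rfl⟩
        have h2 : |f x| = 0 := le_antisymm (hz ▸ h1) (abs_nonneg _)
        simp only [h2, ENNReal.ofReal_zero]
        exact ENNReal.zero_rpow_of_pos hq0
    rw [this, ENNReal.zero_rpow_of_pos (by positivity)]
    exact zero_le
  have hscale : ∀ (u : ℝ → ℝ) (r : ℝ), 0 < r →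
      (∫⁻ x in Ioo (0:ℝ) 1, ENNReal.ofReal |u x| ^ r) ^ (1/r) =
      ENNReal.ofReal M * (∫⁻ x in Ioo (0:ℝ) 1, ENNReal.ofReal |u x / M| ^ r) ^ (1/r) := by
    intro u r hr
    have : ∀ x, ENNReal.ofReal |u x| ^ r = ENNReal.ofReal M ^ r * ENNReal.ofReal |u x / M| ^ r := by
      intro x
      rw [← ENNReal.mul_rpow_of_nonneg _ _ hr.le, ← ENNReal.ofReal_mul hM0, abs_div,
        abs_of_pos hMp, mul_div_cancel₀ _ hMp.ne']
    simp_rw [this]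
    rw [lintegral_const_mul' _ _ (ENNReal.rpow_ne_top_of_nonneg hr.le ENNReal.ofReal_ne_top),
      ENNReal.mul_rpow_of_nonneg _ _ (by positivity), ← ENNReal.rpow_mul, mul_one_div_cancel hr.ne',
      ENNReal.rpow_one]
  rw [hscale f q hq0, hscale f' p hp0, mul_left_comm]
  gcongr
  refine hn (fun x => f x / M) (fun x => f' x / M) (fun x hx => (hd x hx).div_const M) ?_ ?_
  · simpa using h0.div_const M
  · constructor
    · rintro _ ⟨x, hx, rfl⟩
      simp only [abs_div, abs_of_pos hMp]
      exact (div_le_one hMp).2 (hlub.1 ⟨x, hx, rfl⟩)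
    · intro c hc
      have : M ≤ c * M := by
        refine hlub.2 ?_
        rintro _ ⟨x, hx, rfl⟩
        have := hc ⟨x, hx, rfl⟩
        simp only [abs_div, abs_of_pos hMp] at this
        exact (div_le_iff₀ hMp).1 this
      exact le_of_mul_le_mul_right (by linarith) hMp

lemma const_eq {p q B a b : ℝ} (hp : 1 < p) (hq : 1 < q) (hB : 0 < B) (ha : a = 1/q)
    (hb : b = 1 - 1/p) :
    p ^ (1/q) * q ^ (1 - 1/p) * (p * q + p - q) ^ (1/p - 1/q) / ((p - 1) ^ (1/p) * B) =
      (a / (a + b)) ^ a / (a * B * (b / (a + b)) ^ (1/p)) := by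
  have hq0 : 0 < q := by linarith
  have hp0 : 0 < p := by linarith
  have hp1 : 0 < p - 1 := by linarith
  have hD : 0 < p * q + p - q := by nlinarith
  have hs : a + b = (p * q + p - q) / (p * q) := by rw [ha, hb]; field_simp; ring
  have e1 : a / (a + b) = p / (p * q + p - q) := by rw [hs, ha]; field_simp
  have e2 : b / (a + b) = q * (p - 1) / (p * q + p - q) := by rw [hs, hb]; field_simp
  rw [e1, e2, ha, Real.div_rpow hp0.le hD.le, Real.div_rpow (by positivity) hD.le,
    Real.mul_rpow hq0.le hp1.le, Real.rpow_sub hq0, Real.rpow_sub hD, Real.rpow_one]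
  have t1 := rpow_pos_of_pos hD (1/q)
  have t2 := rpow_pos_of_pos hD (1/p)
  have t3 := rpow_pos_of_pos hq0 (1/p)
  have t4 := rpow_pos_of_pos hp1 (1/p)
  generalize (p * q + p - q) ^ (1/q) = X1 at *
  generalize (p * q + p - q) ^ (1/p) = X2 at *
  generalize q ^ (1/p) = X3 at *
  generalize (p-1) ^ (1/p) = X4 at *
  generalize p ^ (1/q) = X5 at *
  field_simp

/-- The optimal (least) constant in the Hardy-type inequality
`‖f‖_{L^q(0,1)} ≤ A ‖f'‖_{L^p(0,1)}` for absolutely continuous `f` on `(0,1)` with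
`f(0) = 0` equals `p^{1/q} q^{1-1/p} (pq+p-q)^{1/p-1/q} / ((p-1)^{1/p} B(1/q, 1-1/p))`,
where `B` denotes the Beta function. -/
theorem hardy_unit_interval_general (p q : ℝ) (hp : 1 < p) (hq : 1 < q) :
    IsLeast {A : ℝ | 0 ≤ A ∧ ∀ f f' : ℝ → ℝ,
        (∀ x ∈ Ioo (0:ℝ) 1, HasDerivAt f (f' x) x) →
        Tendsto f (𝓝[>] (0:ℝ)) (𝓝 0) →
        (∫⁻ x in Ioo (0:ℝ) 1, ENNReal.ofReal |f x| ^ q) ^ (1/q)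
          ≤ ENNReal.ofReal A *
            (∫⁻ x in Ioo (0:ℝ) 1, ENNReal.ofReal |f' x| ^ p) ^ (1/p)}
      (p ^ (1/q) * q ^ (1 - 1/p) * (p * q + p - q) ^ (1/p - 1/q) /
        ((p - 1) ^ (1/p) *
          ∫ t in (0:ℝ)..1, t ^ (1/q - 1) * (1 - t) ^ ((1 - 1/p) - 1))) := by
  have hq0 : 0 < q := by linarith
  have hp0 : 0 < p := by linarith
  obtain ⟨a, ha⟩ : ∃ a, a = 1/q := ⟨_, rfl⟩
  obtain ⟨b, hb⟩ : ∃ b, b = 1 - 1/p := ⟨_, rfl⟩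
  have ha0 : 0 < a := by rw [ha]; positivity
  have hb0 : 0 < b := by rw [hb, sub_pos, div_lt_one hp0]; exact hp
  have hB := hG_pos ha0 hb0
  have eB : ∫ t in (0:ℝ)..1, t ^ (1/q - 1) * (1 - t) ^ ((1 - 1/p) - 1) = hG a b 1 := by
    rw [ha, hb]; rfl
  rw [eB, const_eq hp hq hB ha hb]
  have hK := K_val hq hb0
  rw [← ha] at hK
  obtain ⟨f, f', hd, h0, hI1, hI2⟩ := extremal_fun hp hq ha hb
  set B := hG a b 1
  have hs : 0 < a + b := by positivity
  have hth : 0 < b / (a + b) := by positivity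
  have hth1 : 0 < a / (a + b) := by positivity
  refine ⟨⟨by positivity, ?_⟩, ?_⟩
  · refine upper hp hq (by positivity) ?_
    intro g g' hg hg0 hl
    have := upper_norm2 hp hq ha hb (K := b / (1 + b * q) * B) (by positivity) hK.symm g g' hg hg0 hl
    convert! this using 3
    have e : b / (1 + b * q) = a * (b / (a + b)) := by
      have : q = 1 / a := by rw [ha]; field_simp
      rw [this]; field_simp
    have e2 : (b / (a + b)) ^ b = (b / (a + b)) / (b / (a + b)) ^ (1/p) := by
      rw [hb, Real.rpow_sub (by rw [← hb]; exact hth), Real.rpow_one]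
    rw [e, e2]
    have := rpow_pos_of_pos hth (1/p)
    field_simp
  · rintro A ⟨hA, h⟩
    have := h f f' hd h0
    rw [hI1, hI2, ENNReal.ofReal_rpow_of_nonneg hth1.le (by positivity),
      ENNReal.ofReal_rpow_of_nonneg (by positivity) (by positivity), ← ENNReal.ofReal_mul hA,
      ENNReal.ofReal_le_ofReal_iff (by positivity), Real.mul_rpow (by positivity) hth.le,
      ← Real.rpow_mul (by positivity), mul_one_div_cancel hp0.ne', Real.rpow_one, ← ha] at this
    rw [div_le_iff₀ (by positivity)]
    exact this
end

section
/- Fix 1 < p ≤ q < ∞ and let A be the optimal (least) constant such that (∫_0^1 |f(x)|^q dx)^{1/q} ≤ A·(∫_0^1 |f'(x)|^p dx)^{1/p} holds for every absolutely continuous function f on (0, 1) with f(0) = 0. Define δ̄₁ = p^{1/q}·((p-1)(q+1))^{1 - 1/p} / (pq + p - q)^{1 - 1/p + 1/q}. Then δ̄₁ ≤ A. -/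
open MeasureTheory Real Set Filter Topology ENNReal

lemma hardy_one_mem (p q : ℝ) (hp : 1 < p) (hpq : p ≤ q) (f f' : ℝ → ℝ)
    (hf : ∀ x ∈ Ioo (0:ℝ) 1, HasDerivAt f (f' x) x)
    (h0 : Tendsto f (𝓝[>] (0:ℝ)) (𝓝 0)) :
    (∫⁻ x in Ioo (0:ℝ) 1, ENNReal.ofReal |f x| ^ q) ^ (1/q)
          ≤ ENNReal.ofReal 1 *
            (∫⁻ x in Ioo (0:ℝ) 1, ENNReal.ofReal |f' x| ^ p) ^ (1/p) := by
  have hq : 0 < q := by linarith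
  have hmeas : AEMeasurable f' (volume.restrict (Ioo (0:ℝ) 1)) := by
    refine (measurable_deriv f).aemeasurable.congr ?_
    filter_upwards [ae_restrict_mem measurableSet_Ioo] with x hx
    exact (hf x hx).deriv
  rw [ENNReal.ofReal_one, one_mul]
  set M := (∫⁻ x in Ioo (0:ℝ) 1, ENNReal.ofReal |f' x| ^ p) ^ (1/p) with hM
  by_cases hMt : M = ⊤
  · rw [hMt]; exact le_top
  have hN : ∫⁻ x in Ioo (0:ℝ) 1, ‖f' x‖ₑ ≤ M := by
    have := ENNReal.lintegral_mul_le_Lp_mul_Lq (volume.restrict (Ioo (0:ℝ) 1))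
      (Real.HolderConjugate.conjExponent hp) (f := fun x => ENNReal.ofReal |f' x|) (g := fun _ => 1)
      (by fun_prop) (by fun_prop)
    simpa [hM, Real.enorm_eq_ofReal_abs] using this
  have hint : IntegrableOn f' (Ioo (0:ℝ) 1) :=
    ⟨hmeas.aestronglyMeasurable, lt_of_le_of_lt hN (lt_top_iff_ne_top.2 hMt)⟩
  have hbd : ∀ x ∈ Ioo (0:ℝ) 1, ENNReal.ofReal |f x| ≤ M := by
    intro x hx
    have ht : Tendsto (fun a => |f x - f a|) (𝓝[>] (0:ℝ)) (𝓝 |f x - 0|) :=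
      (tendsto_const_nhds.sub h0).abs
    rw [sub_zero] at ht
    refine ENNReal.ofReal_le_of_le_toReal (le_of_tendsto ht ?_)
    filter_upwards [Ioo_mem_nhdsGT hx.1] with a ha
    have hsub : Ioc a x ⊆ Ioo (0:ℝ) 1 := fun y hy => ⟨ha.1.trans hy.1, hy.2.trans_lt hx.2⟩
    have e : ∫ y in a..x, f' y = f x - f a := by
      apply intervalIntegral.integral_eq_sub_of_hasDerivAt
      · intro y hy
        rw [uIcc_of_le ha.2.le] at hy
        exact hf y ⟨ha.1.trans_le hy.1, hy.2.trans_lt hx.2⟩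
      · rw [intervalIntegrable_iff_integrableOn_Ioc_of_le ha.2.le]
        exact hint.mono_set hsub
    rw [← e, intervalIntegral.integral_of_le ha.2.le]
    rw [← ENNReal.ofReal_le_iff_le_toReal hMt, ← Real.enorm_eq_ofReal_abs]
    exact (enorm_integral_le_lintegral_enorm _).trans ((lintegral_mono_set hsub).trans hN)
  calc (∫⁻ x in Ioo (0:ℝ) 1, ENNReal.ofReal |f x| ^ q) ^ (1/q)
      ≤ (∫⁻ x in Ioo (0:ℝ) 1, M ^ q) ^ (1/q) := by
        refine ENNReal.rpow_le_rpow (setLIntegral_mono' measurableSet_Ioo fun x hx => ?_)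
          (by positivity)
        exact ENNReal.rpow_le_rpow (hbd x hx) hq.le
    _ = M := by
        simp only [lintegral_const, Measure.restrict_apply_univ, Real.volume_Ioo]
        rw [sub_zero, ENNReal.ofReal_one, mul_one, ← ENNReal.rpow_mul, mul_one_div_cancel hq.ne', ENNReal.rpow_one]
  

lemma hardy_int (q c : ℝ) (hq : 1 < q) (hc : 0 < c) (hc1 : c < 1) :
    ∫⁻ x in Ioo (0:ℝ) 1, ENNReal.ofReal (min x c) ^ q
      = ENNReal.ofReal (c ^ q * (1 - c * q / (q+1))) := by
  have hcont : Continuous fun x : ℝ => (min x c) ^ q :=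
    (continuous_id.min continuous_const).rpow_const (fun _ => Or.inr (by linarith))
  have e1 : ∫ x in (0:ℝ)..c, (min x c) ^ q = c ^ (q+1) / (q+1) := by
    rw [intervalIntegral.integral_congr (g := fun x => x ^ q)]
    · rw [integral_rpow (Or.inl (by linarith)), Real.zero_rpow (by linarith), sub_zero]
    · intro x hx
      rw [uIcc_of_le hc.le] at hx
      simp [min_eq_left hx.2]
  have e2 : ∫ x in c..(1:ℝ), (min x c) ^ q = (1 - c) * c ^ q := by
    rw [intervalIntegral.integral_congr (g := fun x => c ^ q)]
    · simp
    · intro x hx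
      rw [uIcc_of_le hc1.le] at hx
      simp [min_eq_right hx.1]
  have e3 := intervalIntegral.integral_add_adjacent_intervals
    (hcont.intervalIntegrable (μ := volume) 0 c) (hcont.intervalIntegrable c 1)
  rw [e1, e2, intervalIntegral.integral_of_le zero_le_one, integral_Ioc_eq_integral_Ioo] at e3
  have e4 : c ^ q * (1 - c * q / (q+1)) = c ^ (q+1) / (q+1) + (1 - c) * c ^ q := by
    rw [Real.rpow_add_one hc.ne']
    have : q + 1 ≠ 0 := by linarith
    field_simp
    ring
  rw [e4, e3, ofReal_integral_eq_lintegral_ofReal]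
  · refine setLIntegral_congr_fun measurableSet_Ioo fun x hx => ?_
    exact ENNReal.ofReal_rpow_of_nonneg (le_min hx.1.le hc.le) (by linarith)
  · exact (hcont.integrableOn_Icc).mono_set Ioo_subset_Icc_self
  · filter_upwards [ae_restrict_mem measurableSet_Ioo] with x hx
    exact Real.rpow_nonneg (le_min hx.1.le hc.le) _

lemma hardy_test (p q : ℝ) (hp : 1 < p) (hpq : p ≤ q) (c ε A : ℝ) (hc : 0 < c) (hc1 : c < 1)
    (hε : 0 < ε) (hA : 0 ≤ A) (h : ∀ f f' : ℝ → ℝ,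
        (∀ x ∈ Ioo (0:ℝ) 1, HasDerivAt f (f' x) x) →
        Tendsto f (𝓝[>] (0:ℝ)) (𝓝 0) →
        (∫⁻ x in Ioo (0:ℝ) 1, ENNReal.ofReal |f x| ^ q) ^ (1/q)
          ≤ ENNReal.ofReal A *
            (∫⁻ x in Ioo (0:ℝ) 1, ENNReal.ofReal |f' x| ^ p) ^ (1/p)) :
    (c ^ q * (1 - c * q / (q+1))) ^ (1/q) ≤ A * (c + ε) ^ (1/p) := by
  have hq : 1 < q := by linarith
  set g : ℝ → ℝ := fun t => max 0 (min 1 (1 - (t - c)/ε)) with hg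
  have gc : Continuous g := by fun_prop
  have g0 : ∀ t, 0 ≤ g t := fun t => le_max_left _ _
  have g1 : ∀ t, g t ≤ 1 := fun t => max_le zero_le_one (min_le_left _ _)
  have gl : ∀ t, t ≤ c → g t = 1 := by
    intro t ht
    have : (t - c)/ε ≤ 0 := div_nonpos_of_nonpos_of_nonneg (by linarith) hε.le
    simp only [hg]
    rw [min_eq_left (by linarith), max_eq_right zero_le_one]
  have gr : ∀ t, c + ε ≤ t → g t = 0 := by
    intro t ht
    have : 1 ≤ (t - c)/ε := by rw [le_div_iff₀ hε]; linarith
    simp only [hg]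
    exact max_eq_left ((min_le_right _ _).trans (by linarith))
  have hF : ∀ x, HasDerivAt (fun y => ∫ t in (0:ℝ)..y, g t) (g x) x := fun x =>
    gc.integral_hasStrictDerivAt 0 x |>.hasDerivAt
  have H := h (fun y => ∫ t in (0:ℝ)..y, g t) g (fun x _ => hF x) (by
    have := (hF 0).continuousAt.tendsto
    simp only [intervalIntegral.integral_same] at this
    exact this.mono_left nhdsWithin_le_nhds)
  have hlow : ∀ x ∈ Ioo (0:ℝ) 1, min x c ≤ ∫ t in (0:ℝ)..x, g t := by
    intro x hx
    have e1 : ∫ t in (0:ℝ)..(min x c), g t = min x c := by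
      rw [intervalIntegral.integral_congr (g := fun x => 1)]
      · simp
      · intro y hy
        rw [uIcc_of_le (le_min hx.1.le hc.le)] at hy
        exact gl y (hy.2.trans (min_le_right _ _))
    have e2 : 0 ≤ ∫ t in (min x c)..x, g t :=
      intervalIntegral.integral_nonneg (min_le_left _ _) fun t _ => g0 t
    have e3 := intervalIntegral.integral_add_adjacent_intervals
      (gc.intervalIntegrable (μ := volume) 0 (min x c)) (gc.intervalIntegrable (min x c) x)
    linarith
  have L : ENNReal.ofReal (c ^ q * (1 - c * q / (q+1))) ≤
      ∫⁻ x in Ioo (0:ℝ) 1, ENNReal.ofReal |∫ t in (0:ℝ)..x, g t| ^ q := by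
    rw [← hardy_int q c hq hc hc1]
    refine setLIntegral_mono' measurableSet_Ioo fun x hx => ?_
    exact ENNReal.rpow_le_rpow (ENNReal.ofReal_le_ofReal ((hlow x hx).trans (le_abs_self _)))
      (by linarith)
  have R : ∫⁻ x in Ioo (0:ℝ) 1, ENNReal.ofReal |g x| ^ p ≤ ENNReal.ofReal (c + ε) := by
    calc ∫⁻ x in Ioo (0:ℝ) 1, ENNReal.ofReal |g x| ^ p
        ≤ ∫⁻ x in Ioo (0:ℝ) 1, (Iio (c+ε)).indicator 1 x := by
          refine lintegral_mono fun x => ?_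
          by_cases hx : x < c + ε
          · rw [indicator_of_mem (by exact hx), abs_of_nonneg (g0 x)]
            refine ENNReal.rpow_le_one ?_ (by linarith)
            simpa using g1 x
          · rw [gr x (not_lt.1 hx)]
            simp [ENNReal.zero_rpow_of_pos (show 0 < p by linarith)]
      _ = volume (Iio (c+ε) ∩ Ioo 0 1) := by
          rw [lintegral_indicator_one measurableSet_Iio, Measure.restrict_apply measurableSet_Iio]
      _ ≤ volume (Ioo 0 (c+ε)) := measure_mono fun y hy => ⟨hy.2.1, hy.1⟩
      _ = _ := by simp
  have hcq : 0 ≤ c ^ q * (1 - c * q / (q+1)) := by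
    refine mul_nonneg (Real.rpow_nonneg hc.le _) ?_
    rw [sub_nonneg, div_le_one (by linarith)]
    nlinarith
  have T := (ENNReal.rpow_le_rpow L (show 0 ≤ 1/q by positivity)).trans (H.trans
    (mul_le_mul_right (ENNReal.rpow_le_rpow R (show 0 ≤ 1/p by positivity)) _))
  rw [ENNReal.ofReal_rpow_of_nonneg hcq (by positivity),
    ENNReal.ofReal_rpow_of_nonneg (by positivity) (by positivity), ← ENNReal.ofReal_mul hA,
    ENNReal.ofReal_le_ofReal_iff (by positivity)] at T
  exact T

/-- Improved lower estimate `δ̄₁ ≤ A` for the optimal Hardy constant on `(0,1)`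
(Lebesgue measures, Dirichlet condition at `0`), where
`δ̄₁ = p^{1/q} ((p-1)(q+1))^{1-1/p} / (pq+p-q)^{1-1/p+1/q}`. -/
theorem hardy_unit_interval_improved_lower (p q : ℝ) (hp : 1 < p) (hpq : p ≤ q) :
    p ^ (1/q) * ((p - 1) * (q + 1)) ^ (1 - 1/p) / (p * q + p - q) ^ (1 - 1/p + 1/q)
      ≤ sInf {A : ℝ | 0 ≤ A ∧ ∀ f f' : ℝ → ℝ,
        (∀ x ∈ Ioo (0:ℝ) 1, HasDerivAt f (f' x) x) →
        Tendsto f (𝓝[>] (0:ℝ)) (𝓝 0) →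
        (∫⁻ x in Ioo (0:ℝ) 1, ENNReal.ofReal |f x| ^ q) ^ (1/q)
          ≤ ENNReal.ofReal A *
            (∫⁻ x in Ioo (0:ℝ) 1, ENNReal.ofReal |f' x| ^ p) ^ (1/p)} := by
  refine le_csInf ⟨1, zero_le_one, fun f f' hf h0 => hardy_one_mem p q hp hpq f f' hf h0⟩ ?_
  rintro A ⟨hA, h⟩
  have hq : 1 < q := by linarith
  have hD : 0 < p * q + p - q := by nlinarith
  have hn : 0 < (p - 1) * (q + 1) := mul_pos (by linarith) (by linarith)
  set D := p * q + p - q with hDdef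
  set c := (p - 1) * (q + 1) / D with hcdef
  have hc : 0 < c := by positivity
  have hc1 : c < 1 := by rw [hcdef, div_lt_one hD]; linarith
  have key : (c ^ q * (1 - c * q / (q+1))) ^ (1/q) ≤ A * c ^ (1/p) := by
    have ht : Tendsto (fun ε : ℝ => A * (c + ε) ^ (1/p)) (𝓝[>] 0) (𝓝 (A * (c + 0) ^ (1/p))) := by
      have : Continuous (fun ε : ℝ => A * (c + ε) ^ (1/p)) :=
        continuous_const.mul ((continuous_const.add continuous_id).rpow_const
          (fun _ => Or.inr (by positivity)))
      exact (this.tendsto 0).mono_left nhdsWithin_le_nhds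
    rw [add_zero] at ht
    refine ge_of_tendsto ht ?_
    filter_upwards [self_mem_nhdsWithin] with ε hε
    exact hardy_test p q hp hpq c ε A hc hc1 hε hA h
  have e1 : 1 - c * q / (q+1) = p / D := by
    have : q + 1 ≠ 0 := by linarith
    rw [hcdef]
    field_simp
    rw [hDdef]; ring
  have hpD : 0 < p / D := by positivity
  rw [e1, Real.mul_rpow (by positivity) hpD.le, ← Real.rpow_mul hc.le, mul_one_div_cancel (by linarith),
    Real.rpow_one] at key
  have e2 : p ^ (1/q) * ((p - 1) * (q + 1)) ^ (1 - 1/p) / D ^ (1 - 1/p + 1/q)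
      = c * (p / D) ^ (1/q) / c ^ (1/p) := by
    have : c = c ^ (1 - 1/p) * c ^ (1/p) := by
      rw [← Real.rpow_add hc]; simp
    have hcp : 0 < c ^ (1/p) := by positivity
    nth_rw 1 [this]
    rw [hcdef] at hcp ⊢
    rw [Real.rpow_add hD, Real.div_rpow hn.le hD.le (1 - 1/p), Real.div_rpow (by positivity) hD.le (1/q)]
    have := Real.rpow_pos_of_pos hD (1 - 1/p)
    have := Real.rpow_pos_of_pos hD (1/q)
    field_simp
  rw [e2, div_le_iff₀ (by positivity)]
  exact key
end

section
/- Fix 1 < p ≤ q < ∞, let p* = p/(p-1), and let A be the optimal (least) constant such that (∫_0^1 |f(x)|^q dx)^{1/q} ≤ A·(∫_0^1 |f'(x)|^p dx)^{1/p} holds for every absolutely continuous function f on (0, 1) with f(0) = 0. Define A* = (p*/q)^{1/q} · [ ((p* + q)/(π p*)) · sin(π p*/(p* + q)) ]^{1/p* + 1/q}. Then A ≤ A*. -/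
open MeasureTheory Real Set Filter Topology ENNReal

lemma hu_term (s t k : ℝ) (hs : 0 < s) (hs1 : s < 1) (ht : 0 < t) (ht1 : t ≤ 1) (hk : 1 ≤ k) :
    ((1 + 1/k) / ((1 + s/k) * (1 + (1-s)/k))) ^ t ≤
      (1 + t/k) / ((1 + t*s/k) * (1 + t*(1-s)/k)) := by
  have hk0 : 0 < k := by linarith
  have h1s : 0 < 1 - s := by linarith
  have hc : 0 < s * (1-s) := mul_pos hs h1s
  have hc1 : s * (1-s) ≤ 1 := by nlinarith
  have e : (1 + 1/k) / ((1 + s/k) * (1 + (1-s)/k)) = 1 + (-(s*(1-s))/((k+s)*(k+(1-s)))) := by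
    field_simp
    ring
  have h2 : (-1:ℝ) ≤ -(s*(1-s))/((k+s)*(k+(1-s))) := by
    rw [le_div_iff₀ (by positivity)]
    nlinarith [mul_pos hk0 hk0]
  rw [e]
  refine (rpow_one_add_le_one_add_mul_self h2 ht.le ht1).trans ?_
  have e2 : (1 + t/k) / ((1 + t*s/k) * (1 + t*(1-s)/k)) =
      k * (k+t) / ((k+t*s)*(k+t*(1-s))) := by
    field_simp
  have e3 : 1 + t * (-(s*(1-s))/((k+s)*(k+(1-s)))) =
     ((k+s)*(k+(1-s)) - t * (s*(1-s)))/((k+s)*(k+(1-s))) := by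
    field_simp
    ring
  rw [e2, e3, div_le_div_iff₀ (by positivity) (by positivity)]
  set c := s * (1-s) with hcd
  have a1 : (k+s)*(k+(1-s)) = k*(k+1) + c := by rw [hcd]; ring
  have a2 : (k+t*s)*(k+t*(1-s)) = k*(k+t) + t^2*c := by rw [hcd]; ring
  rw [a1, a2]
  have h3 : t * c ≤ k^2 := by nlinarith
  have : 0 ≤ (1-t) * t* c * (k^2 - t*c) := by
    apply mul_nonneg (mul_nonneg (mul_nonneg _ ht.le) hc.le) <;> linarith
  have h5 : 0 ≤ (1-t) * c * (k^2 - t*c) := by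
    apply mul_nonneg (mul_nonneg _ hc.le) <;> linarith
  nlinarith

noncomputable def huP (x : ℝ) (n : ℕ) : ℝ := ∏ j ∈ Finset.range n, (1 + x / ((j:ℝ)+1))

lemma huP_pos (x : ℝ) (hx : 0 < x) (n : ℕ) : 0 < huP x n :=
  Finset.prod_pos fun j _ => by positivity

lemma huP_tendsto (x : ℝ) (hx : 0 < x) :
    Tendsto (fun n : ℕ => (n:ℝ)^x / huP x n) atTop (𝓝 (Gamma (1+x))) := by
  have h := (Real.GammaSeq_tendsto_Gamma x).const_mul x
  rw [← Real.Gamma_add_one hx.ne', add_comm] at h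
  refine h.congr fun n => ?_
  unfold Real.GammaSeq huP
  rw [Finset.prod_range_succ']
  have e : ∏ j ∈ Finset.range n, (1 + x / ((j:ℝ)+1)) =
      (∏ j ∈ Finset.range n, (x + ((j+1:ℕ):ℝ))) / (n.factorial:ℝ) := by
    rw [← Finset.prod_range_add_one_eq_factorial, Nat.cast_prod, ← Finset.prod_div_distrib]
    refine Finset.prod_congr rfl fun j _ => ?_
    push_cast
    field_simp
    ring
  rw [e]
  have : 0 < ∏ j ∈ Finset.range n, (x + ((j+1:ℕ):ℝ)) := Finset.prod_pos fun j _ => by positivity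
  have hn : (0:ℝ) < n.factorial := by positivity
  push_cast at *
  field_simp
  ring

lemma hu_gamma (s t : ℝ) (hs : 0 < s) (hs1 : s < 1) (ht : 0 < t) (ht1 : t ≤ 1) :
    (Gamma (1+s) * Gamma (1+(1-s))) ^ t ≤
      Gamma (1+t*s) * Gamma (1+t*(1-s)) / Gamma (1+t) := by
  have h1s : 0 < 1 - s := by linarith
  have T1 := (((huP_tendsto s hs).mul (huP_tendsto (1-s) h1s)).div (huP_tendsto 1 one_pos)
    (by simp [show (1:ℝ)+1 = 2 by norm_num])).rpow_const (p := t) (Or.inr ht.le)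
  have T2 := ((huP_tendsto (t*s) (by positivity)).mul (huP_tendsto (t*(1-s)) (by positivity))).div
    (huP_tendsto t ht) (Gamma_pos_of_pos (by linarith)).ne'
  have e : Gamma (1+1) = 1 := by norm_num
  rw [e, div_one] at T1
  refine le_of_tendsto_of_tendsto T1 T2 ?_
  filter_upwards [eventually_gt_atTop 0] with n hn
  have hn' : (0:ℝ) < n := by exact_mod_cast hn
  simp only [Pi.div_apply]
  have key : (huP 1 n / (huP s n * huP (1-s) n))^t ≤
      huP t n / (huP (t*s) n * huP (t*(1-s)) n) := by
    unfold huP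
    rw [← Finset.prod_mul_distrib, ← Finset.prod_mul_distrib, ← Finset.prod_div_distrib,
      ← Finset.prod_div_distrib, ← Real.finsetProd_rpow]
    · refine Finset.prod_le_prod (fun j _ => by positivity) fun j _ => ?_
      exact hu_term s t _ hs hs1 ht ht1 (by linarith [(Nat.cast_nonneg j : (0:ℝ) ≤ j)])
    · intro j _
      positivity
  have p1 := huP_pos s hs n
  have p2 := huP_pos (1-s) h1s n
  have p3 := huP_pos 1 one_pos n
  have p4 := huP_pos t ht n
  have p5 := huP_pos (t*s) (by positivity) n
  have p6 := huP_pos (t*(1-s)) (by positivity) n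
  have e1 : (n:ℝ)^s / huP s n * ((n:ℝ)^(1-s) / huP (1-s) n) / ((n:ℝ)^(1:ℝ) / huP 1 n)
      = huP 1 n / (huP s n * huP (1-s) n) := by
    have : (n:ℝ)^(1:ℝ) = (n:ℝ)^s * (n:ℝ)^(1-s) := by rw [← rpow_add hn']; congr 1; ring
    rw [this]; field_simp
  have e2 : (n:ℝ)^(t*s) / huP (t*s) n * ((n:ℝ)^(t*(1-s)) / huP (t*(1-s)) n) / ((n:ℝ)^t / huP t n)
      = huP t n / (huP (t*s) n * huP (t*(1-s)) n) := by
    have : (n:ℝ)^t = (n:ℝ)^(t*s) * (n:ℝ)^(t*(1-s)) := by rw [← rpow_add hn']; congr 1; ring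
    rw [this]; field_simp
  rw [e1, e2]
  exact key

lemma hu_K (a b : ℝ) (ha : 0 < a) (hb : 0 < b) :
    ∫ v in (0:ℝ)..1, (1 - v^(1/a))^b = Gamma (1+a) * Gamma (1+b) / Gamma (1+(a+b)) := by
  have h := intervalIntegral.integral_deriv_smul_comp_of_deriv_nonneg (a := 0) (b := 1)
    (f := fun y : ℝ => y^a) (f' := fun y => a * y^(a-1)) (g := fun v : ℝ => (1 - v^(1/a))^b)
    (continuousOn_id.rpow_const (fun _ _ => Or.inr ha.le))
    (by
      intro x hx
      simp at hx
      exact hasDerivAt_rpow_const (Or.inl hx.1.ne'))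
    (by
      intro x hx
      simp at hx
      have := hx.1
      positivity)
  simp only [zero_rpow ha.ne', Real.one_rpow] at h
  rw [← h]
  have hB := ProbabilityTheory.beta_eq_betaIntegralReal a (1+b) ha (by linarith)
  have : (Complex.betaIntegral a ((1+b:ℝ):ℂ)) = ((∫ y in (0:ℝ)..1, y^(a-1) * (1-y)^b : ℝ):ℂ) := by
    unfold Complex.betaIntegral
    rw [← intervalIntegral.integral_ofReal]
    refine intervalIntegral.integral_congr fun x hx => ?_
    simp at hx
    push_cast
    rw [Complex.ofReal_cpow hx.1, Complex.ofReal_cpow (by linarith)]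
    push_cast
    congr 2
    ring
  rw [this, Complex.ofReal_re] at hB
  have e : ∫ x in (0:ℝ)..1, (a * x^(a-1)) • ((fun v : ℝ => (1 - v^(1/a))^b) ∘ fun y => y^a) x
      = a * ∫ y in (0:ℝ)..1, y^(a-1) * (1-y)^b := by
    rw [← intervalIntegral.integral_const_mul]
    refine intervalIntegral.integral_congr fun x hx => ?_
    simp at hx
    simp only [Function.comp, smul_eq_mul]
    rw [← rpow_mul hx.1, mul_one_div_cancel ha.ne', Real.rpow_one]
    ring
  rw [e, ← hB, ProbabilityTheory.beta, add_comm 1 a, Gamma_add_one ha.ne',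
    show a + (1+b) = 1 + (a+b) by ring]
  ring

lemma hu_K_ge (a b : ℝ) (ha : 0 < a) (hb : 0 < b) (hab : a + b ≤ 1) :
    ((a/(a+b)) * (b/(a+b)) * (π / Real.sin (π * (a/(a+b))))) ^ (a+b) ≤
    ∫ v in (0:ℝ)..1, (1 - v^(1/a))^b := by
  rw [hu_K a b ha hb]
  have ht : 0 < a + b := by positivity
  have hs1 : a/(a+b) < 1 := by rw [div_lt_one ht]; linarith
  have e : 1 - a/(a+b) = b/(a+b) := by field_simp; ring
  have h := hu_gamma (a/(a+b)) (a+b) (by positivity) hs1 ht hab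
  rw [show (a+b)*(a/(a+b)) = a by field_simp, show (a+b)*(1-a/(a+b)) = b by rw [e]; field_simp] at h
  convert h using 2
  rw [add_comm 1, add_comm 1, Gamma_add_one (by positivity), Gamma_add_one (by linarith),
    ← Real.Gamma_mul_Gamma_one_sub, e]
  ring

lemma hu_amgm (a b r : ℝ) (ha : 0 < a) (hb : 0 < b) (hr : 0 ≤ r) (hr1 : r ≤ 1) :
    r^a * (1-r)^b ≤ (a/(a+b))^a * (b/(a+b))^b := by
  have ht : 0 < a + b := by positivity
  have h1r : 0 ≤ 1 - r := by linarith
  have h := Real.geom_mean_le_arith_mean2_weighted (w₁ := a/(a+b)) (w₂ := b/(a+b))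
    (p₁ := r/(a/(a+b))) (p₂ := (1-r)/(b/(a+b))) (by positivity) (by positivity) (by positivity)
    (by positivity) (by field_simp)
  have e : a/(a+b) * (r/(a/(a+b))) + b/(a+b) * ((1-r)/(b/(a+b))) = 1 := by
    field_simp; ring
  rw [e] at h
  have h2 := Real.rpow_le_rpow (by positivity) h ht.le
  rw [Real.one_rpow, mul_rpow (by positivity) (by positivity), ← rpow_mul (by positivity),
    ← rpow_mul (by positivity), show a/(a+b)*(a+b) = a by field_simp,
    show b/(a+b)*(a+b) = b by field_simp, div_rpow hr (by positivity),
    div_rpow h1r (by positivity), div_mul_div_comm, div_le_one (by positivity)] at h2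
  exact h2

lemma hu_ftc (φ φ' : ℝ → ℝ) (hd : ∀ x ∈ Ioo (0:ℝ) 1, HasDerivAt φ (φ' x) x)
    (h0 : Tendsto φ (𝓝[>] (0:ℝ)) (𝓝 0)) (hi : IntegrableOn φ' (Ioo 0 1)) :
    ∀ x ∈ Ioo (0:ℝ) 1, |φ x| ≤ ∫ y in Ioo (0:ℝ) 1, |φ' y| := by
  intro x hx
  have T : Tendsto (fun ε => |φ x - φ ε|) (𝓝[>] (0:ℝ)) (𝓝 |φ x - 0|) :=
    (tendsto_const_nhds.sub h0).abs
  rw [sub_zero] at T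
  refine le_of_tendsto T ?_
  filter_upwards [Ioo_mem_nhdsGT hx.1] with ε hε
  have hsub : Ioc ε x ⊆ Ioo 0 1 := fun y hy => ⟨hε.1.trans hy.1, hy.2.trans_lt hx.2⟩
  have hsub' : Icc ε x ⊆ Ioo 0 1 := fun y hy => ⟨hε.1.trans_le hy.1, hy.2.trans_lt hx.2⟩
  have hI : IntervalIntegrable φ' volume ε x := by
    rw [intervalIntegrable_iff_integrableOn_Ioc_of_le hε.2.le]
    exact hi.mono_set hsub
  have h := intervalIntegral.integral_eq_sub_of_hasDerivAt
    (fun y hy => hd y (hsub' (by rwa [uIcc_of_le hε.2.le] at hy))) hI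
  rw [← h, intervalIntegral.integral_of_le hε.2.le]
  calc |∫ y in Ioc ε x, φ' y| ≤ ∫ y in Ioc ε x, |φ' y| := abs_integral_le_integral_abs
    _ ≤ _ := setIntegral_mono_set hi.abs (ae_of_all _ fun _ => abs_nonneg _)
      (LE.le.eventuallyLE hsub)

lemma hu_core (p q : ℝ) (hp : 1 < p) (hq : 0 < q) (f f' : ℝ → ℝ)
    (hd : ∀ x ∈ Ioo (0:ℝ) 1, HasDerivAt f (f' x) x)
    (h0 : Tendsto f (𝓝[>] (0:ℝ)) (𝓝 0)) (hm : Measurable f')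
    (hi : IntegrableOn (fun x => |f' x|^p) (Ioo 0 1)) (C k : ℝ) (hC : 0 ≤ C) (hk : 0 < k)
    (hkK : k ≤ ∫ v in (0:ℝ)..1, (1 - v^q)^(1-1/p))
    (hCk : ∀ r, 0 ≤ r → r ≤ 1 → r^(1/q) * (1-r)^(1-1/p) ≤ C * k) :
    IntegrableOn (fun x => |f x|^q) (Ioo 0 1) ∧
    (∫ x in Ioo (0:ℝ) 1, |f x|^q)^(1/q) ≤ C * (∫ x in Ioo (0:ℝ) 1, |f' x|^p)^(1/p) := by
  have hp0 : 0 < p := by linarith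
  set b := 1 - 1/p with hb
  have hb0 : 0 < b := by rw [hb, sub_pos, div_lt_one hp0]; exact hp
  set μ := volume.restrict (Ioo (0:ℝ) 1) with hμ
  have hfc : ContinuousOn f (Ioo 0 1) := fun x hx => (hd x hx).continuousAt.continuousWithinAt
  have hfm : AEStronglyMeasurable f μ := hfc.aestronglyMeasurable measurableSet_Ioo
  have hmem : MemLp f' (ENNReal.ofReal p) μ := by
    rw [← integrable_norm_rpow_iff hm.aestronglyMeasurable (by simpa using hp0) (by simp)]
    have hi' : Integrable (fun x => |f' x|^p) μ := hi
    simpa [ENNReal.toReal_ofReal hp0.le] using hi'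
  have hint : Integrable f' μ := hmem.integrable (by simpa using hp.le)
  have hbd := hu_ftc f f' hd h0 hint
  set S := (fun x => |f x|) '' Ioo (0:ℝ) 1 with hS
  have hSb : BddAbove S := ⟨_, by rintro _ ⟨x, hx, rfl⟩; exact hbd x hx⟩
  have hSn : S.Nonempty := ⟨_, ⟨1/2, by norm_num, rfl⟩⟩
  set M := sSup S with hM
  have hfM : ∀ x ∈ Ioo (0:ℝ) 1, |f x| ≤ M := fun x hx => le_csSup hSb ⟨x, hx, rfl⟩
  have hM0 : 0 ≤ M := (abs_nonneg _).trans (hfM (1/2) (by norm_num))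
  have hae : ∀ᵐ x ∂μ, x ∈ Ioo (0:ℝ) 1 := ae_restrict_mem measurableSet_Ioo
  have hfq : Integrable (fun x => |f x|^q) μ := by
    refine Integrable.of_bound (C := M^q) ?_ ?_
    · exact ((continuous_abs.rpow_const (fun _ => Or.inr hq.le)).comp_aestronglyMeasurable hfm)
    · filter_upwards [hae] with x hx
      rw [Real.norm_of_nonneg (by positivity)]
      exact Real.rpow_le_rpow (abs_nonneg _) (hfM x hx) hq.le
  refine ⟨hfq, ?_⟩
  set J := ∫ x in Ioo (0:ℝ) 1, |f x|^q with hI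
  set N := (∫ x in Ioo (0:ℝ) 1, |f' x|^p)^(1/p) with hN
  have hN0 : 0 ≤ N := rpow_nonneg (integral_nonneg fun _ => by positivity) _
  have hI0 : 0 ≤ J := integral_nonneg fun _ => by positivity
  have hvol : μ.real univ = 1 := by simp [hμ, Measure.real]
  have hprob : IsProbabilityMeasure μ := ⟨by simp [hμ]⟩
  have hIM : J ≤ M^q := by
    have : ∫ x, M^q ∂μ = M^q := by simp
    rw [← this]
    refine integral_mono_ae hfq (integrable_const _) ?_
    filter_upwards [hae] with x hx
    exact Real.rpow_le_rpow (abs_nonneg _) (hfM x hx) hq.le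
  rcases hM0.eq_or_lt with hMz | hMpos
  · have : J = 0 := le_antisymm (by rw [← hMz, Real.zero_rpow hq.ne'] at hIM; exact hIM) hI0
    rw [this, Real.zero_rpow (by positivity)]
    positivity
  set w : ℝ → ℝ := fun u => (max (M^q - |u|^q) 0)^b with hw
  have hwc : Continuous w := by
    refine Continuous.rpow_const ?_ (fun _ => Or.inr hb0.le)
    exact (continuous_const.sub (continuous_abs.rpow_const (fun _ => Or.inr hq.le))).max
      continuous_const
  have hw0 : ∀ u, 0 ≤ w u := fun u => by positivity
  have hwM : ∀ u, w u ≤ (M^q)^b := fun u => by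
    refine Real.rpow_le_rpow (le_max_right _ _) (max_le ?_ (by positivity)) hb0.le
    have : 0 ≤ |u|^q := by positivity
    linarith
  set W : ℝ → ℝ := fun u => ∫ v in (0:ℝ)..u, w v with hW
  have hWd : ∀ u, HasDerivAt W (w u) u := fun u =>
    intervalIntegral.integral_hasDerivAt_right (hwc.intervalIntegrable _ _)
      (hwc.stronglyMeasurableAtFilter _ _) hwc.continuousAt
  have hWc : Continuous W := continuous_iff_continuousAt.2 fun u => (hWd u).continuousAt
  have hWneg : ∀ u, W (-u) = - W u := by
    intro u
    have h := intervalIntegral.integral_comp_neg (a := 0) (b := u) w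
    have h2 : ∀ v, w (-v) = w v := fun v => by simp [hw]
    simp only [h2, neg_zero] at h
    simp only [hW]
    rw [h, intervalIntegral.integral_symm]
  have hWabs : ∀ u, W |u| ≤ |W u| := by
    intro u
    rcases abs_choice u with h | h <;> rw [h]
    · exact le_abs_self _
    · rw [hWneg]; exact neg_le_abs _
  have hwfm : AEStronglyMeasurable (fun x => w (f x)) μ := hwc.comp_aestronglyMeasurable hfm
  have hwfb : ∀ᵐ x ∂μ, ‖w (f x)‖ ≤ (M^q)^b := ae_of_all _ fun x => by
    rw [Real.norm_of_nonneg (hw0 _)]; exact hwM _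
  have hR := hu_ftc (fun x => W (f x)) (fun x => w (f x) * f' x)
    (fun x hx => (hWd (f x)).comp x (hd x hx))
    (by
      have := (hWc.tendsto 0).comp h0
      simpa [hW, Function.comp_def] using this)
    (hint.bdd_mul hwfm hwfb)
  set R := ∫ y in Ioo (0:ℝ) 1, |w (f y) * f' y| with hRdef
  have hWM : W M ≤ R := by
    obtain ⟨u, -, hu, huS⟩ := exists_seq_tendsto_sSup hSn hSb
    refine le_of_tendsto ((hWc.tendsto M).comp hu) (Eventually.of_forall fun n => ?_)
    obtain ⟨x, hx, hxu⟩ := huS n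
    simp only [Function.comp]
    rw [← hxu]
    exact (hWabs _).trans (hR x hx)
  have hWMk : M * (M^q)^b * k ≤ W M := by
    have e : W M = M * ((M^q)^b * ∫ v in (0:ℝ)..1, (1 - v^q)^b) := by
      have h := intervalIntegral.smul_integral_comp_mul_left (a := 0) (b := 1) w M
      simp only [mul_zero, mul_one, smul_eq_mul] at h
      simp only [hW]
      rw [← h, ← intervalIntegral.integral_const_mul ((M^q)^b)]
      congr 1
      refine intervalIntegral.integral_congr fun v hv => ?_
      simp at hv
      have h1 : v^q ≤ 1 := Real.rpow_le_one hv.1 hv.2 hq.le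
      simp only [hw]
      have hMq' : 0 < M^q := by positivity
      rw [← Real.mul_rpow hMq'.le (sub_nonneg.2 h1), abs_of_nonneg (mul_nonneg hM0 hv.1),
        Real.mul_rpow hM0 hv.1, max_eq_left (by nlinarith)]
      congr 1
      ring
    rw [e, ← mul_assoc]
    gcongr
  have hconj : p.HolderConjugate (1/b) := by
    rw [Real.holderConjugate_iff]
    refine ⟨hp, ?_⟩
    rw [hb]; simp
  have hHol : R ≤ N * (M^q - J)^b := by
    have h := integral_mul_le_Lp_mul_Lq_of_nonneg (μ := μ) hconj (f := fun x => |f' x|)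
      (g := fun x => w (f x)) (ae_of_all _ fun _ => abs_nonneg _) (ae_of_all _ fun _ => hw0 _)
      hmem.abs (MemLp.of_bound hwfm _ hwfb)
    have e1 : R = ∫ x, |f' x| * w (f x) ∂μ := by
      refine integral_congr_ae (ae_of_all _ fun x => ?_)
      simp only
      rw [abs_mul, abs_of_nonneg (hw0 _), mul_comm]
    have e2 : ∫ x, w (f x) ^ (1/b) ∂μ = M^q - J := by
      have : ∫ x, (M^q - |f x|^q) ∂μ = M^q - J := by
        rw [integral_sub (integrable_const _) hfq]
        simp [hI, hμ]
      rw [← this]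
      refine integral_congr_ae ?_
      filter_upwards [hae] with x hx
      have : |f x|^q ≤ M^q := Real.rpow_le_rpow (abs_nonneg _) (hfM x hx) hq.le
      simp only [hw]
      rw [max_eq_left (by linarith), ← Real.rpow_mul (by linarith), mul_one_div_cancel hb0.ne',
        Real.rpow_one]
    rw [e1]
    rw [e2, one_div_one_div] at h
    exact h
  have hMq : 0 < M^q := by positivity
  set r := J / M^q with hr
  have hr0 : 0 ≤ r := by positivity
  have hr1 : r ≤ 1 := by rw [hr, div_le_one hMq]; exact hIM
  have e3 : (M^q - J)^b = (M^q)^b * (1-r)^b := by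
    rw [← Real.mul_rpow hMq.le (by linarith)]
    congr 1
    rw [hr]; field_simp
  have h4 : M * k ≤ N * (1-r)^b := by
    have h5 : (M^q)^b * (M * k) ≤ (M^q)^b * (N * (1-r)^b) := by
      calc (M^q)^b * (M * k) = M * (M^q)^b * k := by ring
        _ ≤ N * (M^q - J)^b := hWMk.trans (hWM.trans hHol)
        _ = _ := by rw [e3]; ring
    exact le_of_mul_le_mul_left h5 (by positivity)
  have e5 : J^(1/q) = M * r^(1/q) := by
    have : J = M^q * r := by rw [hr]; field_simp
    rw [this, Real.mul_rpow hMq.le hr0, ← Real.rpow_mul hM0, mul_one_div_cancel hq.ne',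
      Real.rpow_one]
  have h6 : J^(1/q) * k ≤ (C * N) * k := by
    have hrq : 0 ≤ r^(1/q) := by positivity
    calc J^(1/q) * k = r^(1/q) * (M * k) := by rw [e5]; ring
      _ ≤ r^(1/q) * (N * (1-r)^b) := by gcongr
      _ = N * (r^(1/q) * (1-r)^b) := by ring
      _ ≤ N * (C * k) := mul_le_mul_of_nonneg_left (hCk r hr0 hr1) hN0
      _ = _ := by ring
  exact le_of_mul_le_mul_right h6 hk

/-- Improved upper estimate `A ≤ A*` for the optimal Hardy constant on `(0,1)`
(Lebesgue measures, Dirichlet condition at `0`), where, with `p* = p/(p-1)`,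
`A* = (p*/q)^{1/q} [((p*+q)/(π p*)) sin(π p*/(p*+q))]^{1/p* + 1/q}`. -/
theorem hardy_unit_interval_improved_upper (p q : ℝ) (hp : 1 < p) (hpq : p ≤ q) :
    sInf {A : ℝ | 0 ≤ A ∧ ∀ f f' : ℝ → ℝ,
        (∀ x ∈ Ioo (0:ℝ) 1, HasDerivAt f (f' x) x) →
        Tendsto f (𝓝[>] (0:ℝ)) (𝓝 0) →
        (∫⁻ x in Ioo (0:ℝ) 1, ENNReal.ofReal |f x| ^ q) ^ (1/q)
          ≤ ENNReal.ofReal A *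
            (∫⁻ x in Ioo (0:ℝ) 1, ENNReal.ofReal |f' x| ^ p) ^ (1/p)}
      ≤ (p / (p - 1) / q) ^ (1/q) *
        ((p / (p - 1) + q) / (π * (p / (p - 1))) *
            Real.sin (π * (p / (p - 1)) / (p / (p - 1) + q)))
          ^ ((1 - 1/p) + 1/q) := by
  have hp0 : 0 < p := by linarith
  have hq0 : 0 < q := by linarith
  have hp1 : 0 < p - 1 := by linarith
  obtain ⟨a, ha⟩ : ∃ a, a = 1/q := ⟨_, rfl⟩
  obtain ⟨b, hb⟩ : ∃ b, b = 1 - 1/p := ⟨_, rfl⟩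
  have ha0 : 0 < a := by rw [ha]; positivity
  have hb0 : 0 < b := by rw [hb, sub_pos, div_lt_one hp0]; exact hp
  have hab : a + b ≤ 1 := by
    have : 1/q ≤ 1/p := one_div_le_one_div_of_le hp0 hpq
    rw [ha, hb]; linarith
  have hqa : q = 1/a := by rw [ha]; simp
  have hpb : p/(p-1) = 1/b := by rw [hb]; field_simp
  have ht : 0 < a + b := by positivity
  set s := a/(a+b) with hs
  have hs0 : 0 < s := by positivity
  have h1s0 : 0 < b/(a+b) := by positivity
  have hs1 : s < 1 := by rw [hs, div_lt_one ht]; linarith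
  have hsin : 0 < Real.sin (π * s) :=
    Real.sin_pos_of_pos_of_lt_pi (by positivity) (by nlinarith [Real.pi_pos])
  set k := (s * (b/(a+b)) * (π / Real.sin (π * s)))^(a+b) with hk
  have hk0 : 0 < k := by positivity
  have eA : (p / (p - 1) / q) ^ (1/q) *
        ((p / (p - 1) + q) / (π * (p / (p - 1))) *
            Real.sin (π * (p / (p - 1)) / (p / (p - 1) + q)))
          ^ ((1 - 1/p) + 1/q) = s^a * (b/(a+b))^b / k := by
    rw [← ha, ← hb, hpb, hqa]
    have x1 : 1/b/(1/a) = s / (b/(a+b)) := by rw [hs]; field_simp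
    have x2 : (1/b+1/a)/(π * (1/b)) = 1/(π * s) := by rw [hs]; field_simp
    have x3 : π * (1/b)/(1/b+1/a) = π * s := by rw [hs]; field_simp
    rw [x1, x2, x3, hk, add_comm b a]
    set c := b/(a+b)
    set S := Real.sin (π * s)
    rw [_root_.eq_div_iff (by positivity), mul_assoc, ← Real.mul_rpow (by positivity) (by positivity)]
    have x4 : 1/(π*s) * S * (s * c * (π / S)) = c := by field_simp
    rw [x4, Real.div_rpow hs0.le h1s0.le, Real.rpow_add h1s0]
    have : 0 < c^a := by positivity
    field_simp
  rw [eA]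
  set C := s^a * (b/(a+b))^b / k with hCdef
  have hC0 : 0 < C := by positivity
  refine csInf_le ⟨0, fun A hA => hA.1⟩ ⟨hC0.le, ?_⟩
  intro f f' hd h0
  have hder : ∀ x ∈ Ioo (0:ℝ) 1, f' x = deriv f x := fun x hx => (hd x hx).deriv.symm
  have e1 : ∫⁻ x in Ioo (0:ℝ) 1, ENNReal.ofReal |f' x| ^ p
      = ∫⁻ x in Ioo (0:ℝ) 1, ENNReal.ofReal (|deriv f x| ^ p) := by
    refine setLIntegral_congr_fun measurableSet_Ioo fun x hx => ?_
    rw [hder x hx, ENNReal.ofReal_rpow_of_nonneg (abs_nonneg _) hp0.le]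
  have e2 : ∫⁻ x in Ioo (0:ℝ) 1, ENNReal.ofReal |f x| ^ q
      = ∫⁻ x in Ioo (0:ℝ) 1, ENNReal.ofReal (|f x| ^ q) := by
    refine setLIntegral_congr_fun measurableSet_Ioo fun x hx => ?_
    rw [ENNReal.ofReal_rpow_of_nonneg (abs_nonneg _) hq0.le]
  rw [e1, e2]
  by_cases hfin : ∫⁻ x in Ioo (0:ℝ) 1, ENNReal.ofReal (|deriv f x| ^ p) = ⊤
  · rw [hfin, ENNReal.top_rpow_of_pos (by positivity), ENNReal.mul_top (by simpa using hC0)]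
    exact le_top
  have hmeas : Measurable (fun x => |deriv f x|^p) := by
    have := measurable_deriv f
    fun_prop
  have hint : IntegrableOn (fun x => |deriv f x|^p) (Ioo 0 1) := by
    refine ⟨hmeas.aestronglyMeasurable, ?_⟩
    rw [hasFiniteIntegral_iff_ofReal (ae_of_all _ fun _ => by positivity)]
    exact lt_top_iff_ne_top.2 hfin
  obtain ⟨g1, g2⟩ := hu_core p q hp hq0 f (deriv f) (fun x hx => hder x hx ▸ hd x hx) h0
    (measurable_deriv f) hint C k hC0.le hk0
    (by
      have := hu_K_ge a b ha0 hb0 hab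
      rw [← hqa] at this
      rw [← hb]
      exact this)
    (by
      intro r hr hr1
      rw [hCdef, div_mul_cancel₀ _ hk0.ne', ← ha, ← hb]
      exact hu_amgm a b r ha0 hb0 hr hr1)
  rw [← ofReal_integral_eq_lintegral_ofReal g1 (ae_of_all _ fun _ => by positivity),
    ← ofReal_integral_eq_lintegral_ofReal hint (ae_of_all _ fun _ => by positivity),
    ENNReal.ofReal_rpow_of_nonneg (integral_nonneg fun _ => by positivity) (by positivity),
    ENNReal.ofReal_rpow_of_nonneg (integral_nonneg fun _ => by positivity) (by positivity),
    ← ENNReal.ofReal_mul hC0.le]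
  exact ENNReal.ofReal_le_ofReal g2
end

section
/- Let 1 < p, q < ∞, let μ and ν be Borel measures on the interval (-M, N), let ν# be the absolutely continuous part of ν with respect to Lebesgue measure and define ν̂(dx) = (dν#/dx)^{-1/(p-1)} dx, and let 1/p + 1/p* = 1. For θ ∈ (-M, N) define B_θ^- = sup_{-M<x<θ} ν̂(x, θ)^{1/p*}·μ(-M, x)^{1/q} and B_θ^+ = sup_{θ<y<N} ν̂(θ, y)^{1/p*}·μ(y, N)^{1/q}, and define B* = sup_{-M<x≤y<N} ν̂(x, y)^{(p-1)/p} / { μ(-M, x)^{p/(q(1-p))} + μ(y, N)^{p/(q(1-p))} }^{(p-1)/p}. Then B* ≥ sup_{θ ∈ (-M, N)} min(B_θ^-, B_θ^+). -/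
open MeasureTheory Real Set Filter Topology ENNReal

lemma Bstar_aux (a b w m n c : ℝ≥0∞) (p q : ℝ) (hp : 1 < p) (hq : 1 < q) (hw : a + b ≤ w)
    (h1 : c < a ^ (1 - 1 / p) * m ^ (1 / q)) (h2 : c < b ^ (1 - 1 / p) * n ^ (1 / q)) :
    c ≤ w ^ ((p - 1) / p) / (m ^ (p / (q * (1 - p))) + n ^ (p / (q * (1 - p)))) ^ ((p - 1) / p) := by
  have hp0 : (0:ℝ) < p := by linarith
  have hp1 : (0:ℝ) < p - 1 := by linarith
  have hq0 : (0:ℝ) < q := by linarith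
  have hr : 1 - 1 / p = (p - 1) / p := by field_simp
  have hr0 : 0 < (p - 1) / p := by positivity
  have hs0 : 0 < p / (q * (p - 1)) := by positivity
  have hs : p / (q * (1 - p)) = -(p / (q * (p - 1))) := by
    rw [← div_neg]; congr 1; ring
  have hsr : 1 / q = p / (q * (p - 1)) * ((p - 1) / p) := by field_simp
  rw [hr, hsr, ENNReal.rpow_mul, ← ENNReal.mul_rpow_of_nonneg _ _ hr0.le] at h1 h2
  rw [hs, ENNReal.rpow_neg, ENNReal.rpow_neg, ← ENNReal.div_rpow_of_nonneg _ _ hr0.le]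
  set r := (p - 1) / p
  set u := m ^ (p / (q * (p - 1)))
  set v := n ^ (p / (q * (p - 1)))
  obtain ⟨C, rfl⟩ : ∃ C : ℝ≥0∞, C ^ r = c :=
    ⟨c ^ r⁻¹, by rw [← ENNReal.rpow_mul, inv_mul_cancel₀ hr0.ne', ENNReal.rpow_one]⟩
  rw [ENNReal.rpow_lt_rpow_iff hr0] at h1 h2
  apply ENNReal.rpow_le_rpow _ hr0.le
  have ha : a ≠ 0 := by rintro rfl; simp at h1
  have hu : u ≠ 0 := by intro h; simp [h] at h1
  have hv : v ≠ 0 := by intro h; simp [h] at h2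
  have hw0 : w ≠ 0 := by rintro rfl; simp [ha] at hw
  rw [ENNReal.le_div_iff_mul_le (Or.inr hw0) (Or.inl (by simp [hu, hv])), mul_add]
  refine le_trans (add_le_add ?_ ?_) hw
  · exact ENNReal.div_le_of_le_mul h1.le
  · exact ENNReal.div_le_of_le_mul h2.le

/-- The isoperimetric constant `B*` of the ergodic Hardy inequality dominates
`sup_θ min(B_θ⁻, B_θ⁺)`, where `B_θ⁻`, `B_θ⁺` are the isoperimetric constants of
the Hardy inequalities on the subintervals `(-M, θ)`, `(θ, N)` with Dirichlet
condition at the common endpoint `θ`. -/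
theorem Bstar_ge_sup_min
    (lo hi : EReal) (hlohi : lo < hi)
    (p q : ℝ) (hp : 1 < p) (hq : 1 < q)
    (μ ν : Measure ℝ)
    (νhat : Measure ℝ)
    (hνhat : νhat = volume.withDensity
        fun x => (ν.rnDeriv volume x) ^ (-(1 / (p - 1)) : ℝ))
    (Bminus Bplus : ℝ → ℝ≥0∞)
    (hBminus : ∀ θ : ℝ, Bminus θ = ⨆ (x : ℝ) (_ : lo < (x : EReal)) (_ : x < θ),
        νhat (Ioo x θ) ^ (1 - 1 / p) * μ {t : ℝ | lo < (t : EReal) ∧ t < x} ^ (1 / q))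
    (hBplus : ∀ θ : ℝ, Bplus θ = ⨆ (y : ℝ) (_ : θ < y) (_ : (y : EReal) < hi),
        νhat (Ioo θ y) ^ (1 - 1 / p) * μ {t : ℝ | y < t ∧ (t : EReal) < hi} ^ (1 / q))
    (Bstar : ℝ≥0∞)
    (hBstar : Bstar = ⨆ (x : ℝ) (y : ℝ) (_ : lo < (x : EReal)) (_ : x ≤ y)
        (_ : (y : EReal) < hi),
        νhat (Ioo x y) ^ ((p - 1) / p) /
          ((μ {t : ℝ | lo < (t : EReal) ∧ t < x}) ^ (p / (q * (1 - p)))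
            + (μ {t : ℝ | y < t ∧ (t : EReal) < hi}) ^ (p / (q * (1 - p)))) ^ ((p - 1) / p)) :
    (⨆ (θ : ℝ) (_ : lo < (θ : EReal)) (_ : (θ : EReal) < hi),
        min (Bminus θ) (Bplus θ)) ≤ Bstar := by
  refine iSup_le fun θ => iSup_le fun hθ1 => iSup_le fun hθ2 => ?_
  refine le_of_forall_lt fun c hc => ?_
  obtain ⟨d, hcd, hd⟩ := exists_between hc
  refine lt_of_lt_of_le hcd ?_
  obtain ⟨hm, hpl⟩ := lt_min_iff.1 hd
  rw [hBminus] at hm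
  rw [hBplus] at hpl
  simp only [lt_iSup_iff] at hm hpl
  obtain ⟨x, hx, hxθ, h1⟩ := hm
  obtain ⟨y, hθy, hy, h2⟩ := hpl
  have hw : νhat (Ioo x θ) + νhat (Ioo θ y) ≤ νhat (Ioo x y) := by
    rw [← measure_union (Set.disjoint_left.2 fun t h h' => lt_asymm h.2 h'.1) measurableSet_Ioo]
    exact measure_mono (Set.union_subset (Ioo_subset_Ioo_right hθy.le)
      (Ioo_subset_Ioo_left hxθ.le))
  refine (Bstar_aux _ _ _ _ _ d p q hp hq hw h1 h2).trans ?_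
  rw [hBstar]
  exact le_iSup_of_le x (le_iSup_of_le y (le_iSup_of_le hx (le_iSup_of_le (hxθ.trans hθy).le
    (le_iSup_of_le hy le_rfl))))
end
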